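/- arXiv:1310.6146 — 2 statements merged into one kernel-verified Lean document; each statement's English description precedes it below -/
import Mathlib

section
/- Expansion of the expected value of a functional of the SRK approximation: Let (Ω,𝓕,P) be a probability space carrying bounded random variables ϑ_ι, ι∈M, set θ_ι(h)=√h·ϑ_ι and θ_0(h)=h, and let Y(t)=Y(t_0+h) with Y(t_0)=x_0∈ℝ^d be the one-step value of an autonomous s-stage SRK method, where almost surely the stage equations possess a solution depending (2p+2)-times continuously differentiably on θ on the segment joining 0 and θ(h). Let p∈ℕ and assume f and all components of a and b^j, 1≤j≤m, belong to C_P^{2(p+1)}(ℝ^d,ℝ). Then there exists h_0>0 such that for all h∈(0,h_0): E(f(Y(t))) = Σ over all t∈LTS(Δ) with ρ(t)≤p+1/2 of Σ_{j_1,…,j_{s(t)}=1}^m γ(t)·F(t)(x_0)·E(Φ_S(t))/(l(t)−1)! + O(h^{p+1}), i.e. the difference of the two sides is bounded in absolute value by C·h^{p+1} for a constant C independent of h. -/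
open scoped BigOperators
open Finset MeasureTheory ProbabilityTheory

noncomputable section

namespace SRKPaper

/-- `ℝ^d` with the Euclidean norm. -/
abbrev Evec (d : ℕ) : Type := EuclideanSpace ℝ (Fin d)

/-- The index pairs `(k,ν)` of the SRK method: `det` is `(0,0)`,
`sto k ν` is `(k,ν)` with `k ∈ {1,…,m}`, `ν ∈ M`. -/
inductive SIdx (m : ℕ) (M : Type) : Type where
  | det : SIdx m M
  | sto : Fin m → M → SIdx m M

/-- `M̄ = M ∪ {0}`, with `none` playing the role of the index `0`. -/
abbrev Mbar (M : Type) : Type := Option M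

/-- The real coefficients of an autonomous `s`-stage stochastic Runge–Kutta method. -/
structure SRK (m s : ℕ) (M : Type) : Type where
  α : Fin s → ℝ
  γc : M → SIdx m M → Fin s → ℝ
  A : SIdx m M → Fin s → Fin s → ℝ
  B : M → SIdx m M → Fin m → M → Fin s → Fin s → ℝ

variable {d m s : ℕ} {M : Type}

section SRKdefs
variable [Fintype M]

/-- θ-dependent weights `z^{(k,ν)}`. -/
def SRK.z (c : SRK m s M) (θ : Mbar M → ℝ) : SIdx m M → Fin s → ℝ
  | .det => fun i => c.α i * θ none
  | .sto k ν => fun i => ∑ ι : M, c.γc ι (.sto k ν) i * θ (some ι)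

/-- θ-dependent stage coefficients `Z^{(k,ν),(r,μ)}`; the first index is the
father pair `p = (k,ν)`, the second the son pair. -/
def SRK.Z (c : SRK m s M) (θ : Mbar M → ℝ) (p : SIdx m M) : SIdx m M → Fin s → Fin s → ℝ
  | .det => fun i j => c.A p i j * θ none
  | .sto r μ => fun i j => ∑ ι : M, c.B ι p r μ i j * θ (some ι)

/-- The stage equations of the autonomous SRK method with starting value `y0`. -/
def StageEq (c : SRK m s M) (a : Evec d → Evec d) (b : Fin m → Evec d → Evec d)
    (y0 : Evec d) (θ : Mbar M → ℝ) (H : SIdx m M → Fin s → Evec d) : Prop :=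
  ∀ (p : SIdx m M) (i : Fin s),
    H p i = y0 + (∑ j, c.Z θ p .det i j • a (H .det j))
      + ∑ j, ∑ r, ∑ μ, c.Z θ p (.sto r μ) i j • b r (H (.sto r μ) j)

/-- The one-step value `Y(t)` of the SRK method. -/
def oneStep (c : SRK m s M) (a : Evec d → Evec d) (b : Fin m → Evec d → Evec d)
    (y0 : Evec d) (θ : Mbar M → ℝ) (H : SIdx m M → Fin s → Evec d) : Evec d :=
  y0 + (∑ i, c.z θ .det i • a (H .det i))
    + ∑ i, ∑ k, ∑ ν, c.z θ (.sto k ν) i • b k (H (.sto k ν) i)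

end SRKdefs

/-- A monotonically labelled S-tree with `l+1` nodes: node `0` is the root, the
nonroot nodes are labelled `1,…,l` and are represented by `Fin l` (node `i : Fin l`
has true label `i+1`).  `father i` is the father of node `i+1` (a node label in
`Fin (l+1)`), and `color i` is the colour of node `i+1`: `none` is a deterministic
node `τ`, `some j` a stochastic node `σ_j` with (concrete) variable index `j`. -/
structure STree (l m : ℕ) : Type where
  father : Fin l → Fin (l + 1)
  color : Fin l → Option (Fin m)
  mono : ∀ i : Fin l, (father i).val ≤ i.val

def STree.equivSubtype (l m : ℕ) :
    STree l m ≃ {p : (Fin l → Fin (l+1)) × (Fin l → Option (Fin m)) //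
      ∀ i : Fin l, (p.1 i).val ≤ i.val} where
  toFun t := ⟨(t.father, t.color), t.mono⟩
  invFun p := ⟨p.1.1, p.1.2, p.2⟩
  left_inv t := rfl
  right_inv p := rfl

instance (l m : ℕ) : Fintype (STree l m) := Fintype.ofEquiv _ (STree.equivSubtype l m).symm

/-- The set of sons of the node with label `v`. -/
def STree.child {l m : ℕ} (t : STree l m) (v : Fin (l+1)) : Finset (Fin l) :=
  Finset.univ.filter fun i => t.father i = v

/-- interpretation of a colour by the corresponding coefficient function (`b^0 = a`). -/
def nodeFun (a : Evec d → Evec d) (b : Fin m → Evec d → Evec d) :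
    Option (Fin m) → Evec d → Evec d
  | none => a
  | some j => b j

/-- The elementary differential attached to the subtree rooted at the nonroot node `i`
(fuel-based recursion; the fuel `l` always suffices). -/
def elemFAux (a : Evec d → Evec d) (b : Fin m → Evec d → Evec d) {l : ℕ} (t : STree l m) :
    ℕ → Fin l → Evec d → Evec d
  | 0, _, _ => 0
  | fuel + 1, i, x =>
      iteratedFDeriv ℝ (t.child i.succ).card (nodeFun a b (t.color i)) x
        fun p => elemFAux a b t fuel ((t.child i.succ).orderIsoOfFin rfl p).1 x

def elemF (a : Evec d → Evec d) (b : Fin m → Evec d → Evec d) {l : ℕ} (t : STree l m)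
    (i : Fin l) : Evec d → Evec d := elemFAux a b t l i

/-- The elementary differential `F(t)(x)` of a tree whose root has colour `γ`
(representing the functional `f`). -/
def elemFRoot (f : Evec d → ℝ) (a : Evec d → Evec d) (b : Fin m → Evec d → Evec d)
    {l : ℕ} (t : STree l m) (x : Evec d) : ℝ :=
  iteratedFDeriv ℝ (t.child 0).card f x
    fun p => elemF a b t ((t.child 0).orderIsoOfFin rfl p).1 x

/-- The elementary differential `F(t)(x)` of a tree whose root has colour `rc`
(`none = τ`, `some j = σ_j`). -/
def elemFRootV (a : Evec d → Evec d) (b : Fin m → Evec d → Evec d) (rc : Option (Fin m))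
    {l : ℕ} (t : STree l m) (x : Evec d) : Evec d :=
  iteratedFDeriv ℝ (t.child 0).card (nodeFun a b rc) x
    fun p => elemF a b t ((t.child 0).orderIsoOfFin rfl p).1 x

/-- number of nodes of the subtree rooted at the nonroot node `i` (fuel-based). -/
def sizeAux {l m : ℕ} (t : STree l m) : ℕ → Fin l → ℕ
  | 0, _ => 0
  | fuel + 1, i => 1 + ∑ c ∈ t.child i.succ, sizeAux t fuel c

def STree.size {l m : ℕ} (t : STree l m) (i : Fin l) : ℕ := sizeAux t l i

/-- density of the subtree rooted at the nonroot node `i`. -/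
def densAux {l m : ℕ} (t : STree l m) : ℕ → Fin l → ℕ
  | 0, _ => 1
  | fuel + 1, i => t.size i * ∏ c ∈ t.child i.succ, densAux t fuel c

def STree.densNode {l m : ℕ} (t : STree l m) (i : Fin l) : ℕ := densAux t l i

/-- density `γ(t)` of a tree whose root has colour `γ`. -/
def STree.densDelta {l m : ℕ} (t : STree l m) : ℕ := ∏ c ∈ t.child 0, t.densNode c

/-- density `γ(t)` of a tree (with `l+1` nodes) whose root has colour `τ` or `σ_j`. -/
def STree.densR {l m : ℕ} (t : STree l m) : ℕ := (l+1) * ∏ c ∈ t.child 0, t.densNode c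

/-- number `s(t)` of stochastic nonroot nodes. -/
def STree.scount {l m : ℕ} (t : STree l m) : ℕ :=
  (Finset.univ.filter fun i : Fin l => (t.color i).isSome = true).card

/-- number `d(t)` of deterministic nonroot nodes. -/
def STree.dcount {l m : ℕ} (t : STree l m) : ℕ :=
  (Finset.univ.filter fun i : Fin l => t.color i = none).card

section PhiDefs
variable [Fintype M]

/-- The vector `Ψ^{(p)}` of the subtree rooted at the nonroot node `i`, where `p` is
the index pair of the father of `i` (fuel-based recursion). -/
def PsiAux (c : SRK m s M) (θ : Mbar M → ℝ) {l : ℕ} (t : STree l m) :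
    ℕ → Fin l → SIdx m M → Fin s → ℝ
  | 0, _, _, _ => 1
  | fuel + 1, i, p, q =>
    match t.color i with
    | none => ∑ j, c.Z θ p .det q j * ∏ cc ∈ t.child i.succ, PsiAux c θ t fuel cc .det j
    | some jj => ∑ μ : M, ∑ j, c.Z θ p (.sto jj μ) q j *
        ∏ cc ∈ t.child i.succ, PsiAux c θ t fuel cc (.sto jj μ) j

def PsiN (c : SRK m s M) (θ : Mbar M → ℝ) {l : ℕ} (t : STree l m)
    (i : Fin l) (p : SIdx m M) (q : Fin s) : ℝ := PsiAux c θ t l i p q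

/-- the elementary-weight factor contributed by the subtree rooted at a son of the root. -/
def phiFactor (c : SRK m s M) (θ : Mbar M → ℝ) {l : ℕ} (t : STree l m) (i : Fin l) : ℝ :=
  match t.color i with
  | none => ∑ j, c.z θ .det j * ∏ cc ∈ t.child i.succ, PsiN c θ t cc .det j
  | some jj => ∑ μ : M, ∑ j, c.z θ (.sto jj μ) j *
      ∏ cc ∈ t.child i.succ, PsiN c θ t cc (.sto jj μ) j

/-- The elementary weight `Φ_S(t)` of a `γ`-rooted tree. -/
def PhiS (c : SRK m s M) (θ : Mbar M → ℝ) {l : ℕ} (t : STree l m) : ℝ :=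
  ∏ i ∈ t.child 0, phiFactor c θ t i

/-- `∑_{i₁} Z^{(k,ν)}_{i,i₁} Φ_{i₁}(t)` for a tree with root colour `rc`, the sum over
the pair `(j_r,ν_r)` of the root being shared between the `Z`-factor and `Φ`. -/
def ZPhi (c : SRK m s M) (θ : Mbar M → ℝ) (p : SIdx m M) (i : Fin s)
    (rc : Option (Fin m)) {l : ℕ} (t : STree l m) : ℝ :=
  match rc with
  | none => ∑ i1, c.Z θ p .det i i1 * ∏ cc ∈ t.child 0, PsiN c θ t cc .det i1
  | some jr => ∑ ν : M, ∑ i1, c.Z θ p (.sto jr ν) i i1 *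
      ∏ cc ∈ t.child 0, PsiN c θ t cc (.sto jr ν) i1

/-- `∑_{i₁} z_{i₁} Φ_{i₁}(t)` for a tree with root colour `rc`. -/
def zPhi (c : SRK m s M) (θ : Mbar M → ℝ)
    (rc : Option (Fin m)) {l : ℕ} (t : STree l m) : ℝ :=
  match rc with
  | none => ∑ i1, c.z θ .det i1 * ∏ cc ∈ t.child 0, PsiN c θ t cc .det i1
  | some jr => ∑ ν : M, ∑ i1, c.z θ (.sto jr ν) i1 *
      ∏ cc ∈ t.child 0, PsiN c θ t cc (.sto jr ν) i1

end PhiDefs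

/-- `D^q` with increments `Δ` applied to `g` at the point `θ0`:
`∑_{ν₁,…,ν_q ∈ M̄} Δθ_{ν₁}⋯Δθ_{ν_q} ∂^q g/(∂θ_{ν₁}⋯∂θ_{ν_q})(θ0)`. -/
def Dq {ι : Type} [Fintype ι] [DecidableEq ι] {F : Type}
    [NormedAddCommGroup F] [NormedSpace ℝ F]
    (q : ℕ) (Δ : ι → ℝ) (g : (ι → ℝ) → F) (θ0 : ι → ℝ) : F :=
  ∑ νs : Fin q → ι, (∏ r, Δ (νs r)) •
    iteratedFDeriv ℝ q g θ0 fun r => Pi.single (νs r) 1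

/-- `∑_{ν₁,…,ν_q ∈ M̄} ∂^q g/(∂θ_{ν₁}⋯∂θ_{ν_q})(θ0)`. -/
def DerSum {ι : Type} [Fintype ι] [DecidableEq ι] {F : Type}
    [NormedAddCommGroup F] [NormedSpace ℝ F]
    (q : ℕ) (g : (ι → ℝ) → F) (θ0 : ι → ℝ) : F :=
  ∑ νs : Fin q → ι, iteratedFDeriv ℝ q g θ0 fun r => Pi.single (νs r) 1

/-- the space `C_P^l`: `l` times continuously differentiable with all derivatives up
to order `l` of polynomial growth. -/
def IsCP {d : ℕ} {F : Type} [NormedAddCommGroup F] [NormedSpace ℝ F]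
    (l : ℕ) (g : Evec d → F) : Prop :=
  ContDiff ℝ l g ∧ ∀ i : ℕ, i ≤ l → ∃ K > (0:ℝ), ∃ r : ℕ,
    ∀ x, ‖iteratedFDeriv ℝ i g x‖ ≤ K * (1 + ‖x‖ ^ (2*r))

/-- A labelled tree is special if no node except possibly the root has more than one son. -/
def IsSpecial {q : ℕ} (t : STree q 0) : Prop :=
  ∀ i : Fin q, (t.child i.succ).card ≤ 1

instance {q : ℕ} : DecidablePred (IsSpecial (q := q)) := fun t => by
  unfold IsSpecial; infer_instance

end SRKPaper

namespace SRKPaper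

/-- Inserting `v` in the first slot of every multilinear map of a series. -/
def plug {X W : Type} [NormedAddCommGroup X] [NormedSpace ℝ X] [NormedAddCommGroup W]
    [NormedSpace ℝ W] (v : X) (q : FormalMultilinearSeries ℝ X W) :
    FormalMultilinearSeries ℝ X W :=
  fun k => (q (k + 1)).curryLeft v

section Analysis

variable {X W E F G : Type} [NormedAddCommGroup X] [NormedSpace ℝ X]
  [NormedAddCommGroup W] [NormedSpace ℝ W]
  [NormedAddCommGroup E] [NormedSpace ℝ E] [NormedAddCommGroup F] [NormedSpace ℝ F]
  [NormedAddCommGroup G] [NormedSpace ℝ G]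

/-- Directional derivatives commute with iterated derivatives. -/
theorem iteratedFDeriv_succ_cons (k : ℕ) {W : Type} [NormedAddCommGroup W] [NormedSpace ℝ W]
    {φ : X → W} (hφ : ContDiff ℝ (k + 1 : ℕ) φ) (x v : X) (L : Fin k → X) :
    iteratedFDeriv ℝ (k + 1) φ x (Fin.cons v L) =
      iteratedFDeriv ℝ k (fun y => fderiv ℝ φ y v) x L := by
  induction k generalizing W with
  | zero => simp
  | succ k ih =>
    have h1 : ContDiff ℝ (k + 1 : ℕ) (fderiv ℝ φ) := hφ.fderiv_right (by norm_cast)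
    rw [iteratedFDeriv_succ_apply_right]
    have hinit : Fin.init (Fin.cons v L : Fin (k + 2) → X) = Fin.cons v (Fin.init L) := by
      ext i
      refine Fin.cases ?_ (fun j => ?_) i <;> simp [Fin.init]
    have hlast : (Fin.cons v L : Fin (k + 2) → X) (Fin.last (k + 1)) = L (Fin.last k) := by
      rw [← Fin.succ_last, Fin.cons_succ]
    rw [hinit, hlast, ih h1, iteratedFDeriv_succ_apply_right]
    congr 2
    refine congrArg (fun g => iteratedFDeriv ℝ k g x) (funext fun y => ?_)
    have h2 : DifferentiableAt ℝ (fderiv ℝ φ) y :=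
      (h1.differentiable (by simp)) y
    have hsymm : IsSymmSndFDerivAt ℝ φ y :=
      (hφ.contDiffAt.of_le (m := 2) (by exact_mod_cast (by omega : 2 ≤ k + 1 + 1))).isSymmSndFDerivAt
        (by simp)
    ext u
    rw [fderiv_clm_apply h2 (differentiableAt_const v)]
    simpa using hsymm.eq v u

/-- Leibniz rule for higher derivatives of a bilinear expression. -/
theorem iteratedDeriv_bilinear (B : E →L[ℝ] F →L[ℝ] G) (n : ℕ) {x : ℝ → E} {y : ℝ → F}
    (hx : ContDiff ℝ n x) (hy : ContDiff ℝ n y) (t : ℝ) :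
    iteratedDeriv n (fun r => B (x r) (y r)) t =
      ∑ i ∈ range (n + 1), n.choose i • B (iteratedDeriv i x t) (iteratedDeriv (n - i) y t) := by
  induction n generalizing t with
  | zero => simp
  | succ n ih =>
    have hfun : iteratedDeriv n (fun r => B (x r) (y r)) = fun r =>
        ∑ i ∈ range (n + 1),
          n.choose i • B (iteratedDeriv i x r) (iteratedDeriv (n - i) y r) :=
      funext fun r => ih (hx.of_le (by norm_cast; omega)) (hy.of_le (by norm_cast; omega)) r
    rw [iteratedDeriv_succ, hfun,
      sum_choose_succ_nsmul (fun i j => B (iteratedDeriv i x t) (iteratedDeriv j y t)) n,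
      ← sum_add_distrib]
    refine HasDerivAt.deriv (HasDerivAt.fun_sum fun i hi => ?_)
    have hi' : i ≤ n := Nat.lt_succ_iff.mp (mem_range.mp hi)
    have dx : HasDerivAt (iteratedDeriv i x) (iteratedDeriv (i + 1) x t) t := by
      rw [iteratedDeriv_succ]
      exact (hx.differentiable_iteratedDeriv i (by norm_cast; omega) t).hasDerivAt
    have dy : HasDerivAt (iteratedDeriv (n - i) y) (iteratedDeriv (n + 1 - i) y t) t := by
      rw [show n + 1 - i = (n - i) + 1 by omega, iteratedDeriv_succ]
      exact (hy.differentiable_iteratedDeriv (n - i) (by norm_cast; omega) t).hasDerivAt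
    rw [← smul_add]
    refine HasDerivAt.fun_const_smul (n.choose i) ?_
    simpa [add_comm] using B.hasDerivAt_of_bilinear (fun _ => dx) (fun _ => dy)

/-- The derivatives at `0` of `φ ∘ h` in terms of the series `q` of derivatives of `φ` at `h 0`
and of the derivatives `u n` of order `n + 1` of `h` at `0`. -/
def wsum (u : ℕ → X) : ℕ → FormalMultilinearSeries ℝ X W → W
  | 0, q => q 0 0
  | l + 1, q => ∑ n : Fin (l + 1), l.choose n • wsum u (l - n) (plug (u n) q)
termination_by l => l
decreasing_by omega

theorem wsum_zero (u : ℕ → X) (q : FormalMultilinearSeries ℝ X W) : wsum u 0 q = q 0 0 := by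
  rw [wsum]

theorem wsum_succ (u : ℕ → X) (l : ℕ) (q : FormalMultilinearSeries ℝ X W) :
    wsum u (l + 1) q = ∑ n ∈ range (l + 1), l.choose n • wsum u (l - n) (plug (u n) q) := by
  rw [wsum, Finset.sum_range (fun n => l.choose n • wsum u (l - n) (plug (u n) q))]

theorem wsum_congr {u u' : ℕ → X} (l : ℕ) {q q' : FormalMultilinearSeries ℝ X W}
    (hu : ∀ n < l, u n = u' n) (hq : ∀ k ≤ l, q k = q' k) : wsum u l q = wsum u' l q' := by
  induction l using Nat.strong_induction_on generalizing q q' with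
  | _ l ih =>
    cases l with
    | zero => rw [wsum_zero, wsum_zero, hq 0 le_rfl]
    | succ l =>
      rw [wsum_succ, wsum_succ]
      refine sum_congr rfl fun n hn => ?_
      have hn' := mem_range.mp hn
      rw [hu n hn', ih (l - n) (by omega) (fun j hj => hu j (by omega)) fun k hk => ?_]
      rw [plug, plug, hq (k + 1) (by omega)]

/-- The derivatives at `0` of the solution of `h t = h 0 + t • G (h t)`, where `g` is the series
of derivatives of `G` at `h 0`; the entry `n` is the derivative of order `n + 1`. -/
def usum (g : FormalMultilinearSeries ℝ X X) : ℕ → X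
  | n => (n + 1) • wsum (fun j => if _h : j < n then usum g j else 0) n g
termination_by n => n

theorem usum_eq (g : FormalMultilinearSeries ℝ X X) (n : ℕ) :
    usum g n = (n + 1) • wsum (usum g) n g := by
  rw [usum]
  congr 1
  exact wsum_congr n (fun j hj => by simp [hj]) fun _ _ => rfl

theorem ftaylorSeries_plug {N : ℕ} {φ : X → W} (hφ : ContDiff ℝ (N + 1 : ℕ) φ) (x v : X) {k : ℕ}
    (hk : k ≤ N) :
    plug v (ftaylorSeries ℝ φ x) k = ftaylorSeries ℝ (fun y => fderiv ℝ φ y v) x k := by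
  ext L
  exact iteratedFDeriv_succ_cons k (hφ.of_le (by norm_cast; omega)) x v L

theorem iteratedDeriv_comp_eq_wsum {h : ℝ → X} {u : ℕ → X} (l : ℕ) (hh : ContDiff ℝ l h)
    (hu : ∀ n < l, iteratedDeriv (n + 1) h 0 = u n) {φ : X → W} (hφ : ContDiff ℝ l φ) :
    iteratedDeriv l (fun t => φ (h t)) 0 = wsum u l (ftaylorSeries ℝ φ (h 0)) := by
  induction l using Nat.strong_induction_on generalizing φ with
  | _ l ih =>
    cases l with
    | zero =>
      rw [wsum_zero]
      simp [ftaylorSeries]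
    | succ l =>
      have hφ1 : ContDiff ℝ l (fderiv ℝ φ) := hφ.fderiv_right (by norm_cast)
      have hh1 : ContDiff ℝ l h := hh.of_le (by norm_cast; omega)
      have hd : deriv (fun t => φ (h t)) =
          fun t => (ContinuousLinearMap.apply ℝ W) (deriv h t) (fderiv ℝ φ (h t)) := by
        ext t
        have := (hφ.differentiable (by simp) (h t)).hasFDerivAt.comp_hasDerivAt t
          (hh.differentiable (by simp) t).hasDerivAt
        exact this.deriv
      have hdh : ContDiff ℝ l (deriv h) := by
        have := (contDiff_succ_iff_deriv (n := l) (f := h)).mp (by exact_mod_cast hh)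
        exact this.2.2
      rw [iteratedDeriv_succ', hd, iteratedDeriv_bilinear (y := fun t => fderiv ℝ φ (h t)) _ l hdh
        (hφ1.comp hh1), wsum_succ]
      refine sum_congr rfl fun n hn => ?_
      have hn' := mem_range.mp hn
      have hle : ((l - n : ℕ) : WithTop ℕ∞) ≤ l := by norm_cast; omega
      rw [← iteratedDeriv_succ', hu n hn']
      congr 1
      have h1 : ContDiff ℝ (l - n : ℕ) (fun t => fderiv ℝ φ (h t)) := (hφ1.comp hh1).of_le hle
      have h2 := ((ContinuousLinearMap.apply ℝ W) (u n)).iteratedFDeriv_comp_left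
        (x := 0) h1.contDiffAt le_rfl
      have h3 : ContDiff ℝ (l - n : ℕ) (fun y => fderiv ℝ φ y (u n)) :=
        (hφ1.clm_apply contDiff_const).of_le hle
      have h4 := ih (l - n) (by omega) (hh1.of_le hle) (fun j hj => hu j (by omega)) h3
      rw [wsum_congr (l - n) (fun _ _ => rfl)
        (fun k hk => ftaylorSeries_plug hφ (h 0) (u n) (k := k) (by omega)), ← h4,
        iteratedDeriv, iteratedDeriv]
      exact (congrArg (fun q => q fun _ => (1 : ℝ)) h2).symm

end Analysis

section Picard

variable {X : Type} [NormedAddCommGroup X] [NormedSpace ℝ X]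

theorem iteratedDeriv_id_smul (n : ℕ) {f : ℝ → X} (hf : ContDiff ℝ (n + 1 : ℕ) f) (t : ℝ) :
    iteratedDeriv (n + 1) (fun r => r • f r) t =
      t • iteratedDeriv (n + 1) f t + (n + 1) • iteratedDeriv n f t := by
  induction n generalizing t with
  | zero =>
    have := (hasDerivAt_id t).smul (hf.differentiable (by simp) t).hasDerivAt
    simp only [zero_add, iteratedDeriv_one, iteratedDeriv_zero, one_smul]
    refine (HasDerivAt.deriv this).trans ?_
    simp
  | succ n ih =>
    have hfun : iteratedDeriv (n + 1) (fun r => r • f r) = fun r =>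
        r • iteratedDeriv (n + 1) f r + (n + 1) • iteratedDeriv n f r :=
      funext fun r => ih (hf.of_le (by norm_cast; omega)) r
    have h1 : HasDerivAt (iteratedDeriv (n + 1) f) (iteratedDeriv (n + 2) f t) t := by
      rw [iteratedDeriv_succ (n := n + 1)]
      exact (hf.differentiable_iteratedDeriv (n + 1) (by norm_cast; omega) t).hasDerivAt
    have h0 : HasDerivAt (iteratedDeriv n f) (iteratedDeriv (n + 1) f t) t := by
      rw [iteratedDeriv_succ (n := n)]
      exact (hf.differentiable_iteratedDeriv n (by norm_cast; omega) t).hasDerivAt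
    rw [iteratedDeriv_succ, hfun]
    have := ((hasDerivAt_id t).smul h1).add (h0.fun_const_smul (n + 1))
    refine (HasDerivAt.deriv this).trans ?_
    simp only [id, one_smul, add_assoc, ← succ_nsmul']

/-- Picard iteration for the equation `h t = x + t • G (h t)`. -/
def picard (G : X → X) (x : X) : ℕ → ℝ → X
  | 0, _ => x
  | n + 1, t => x + t • G (picard G x n t)

variable {G : X → X} {x : X}

theorem picard_at_zero (n : ℕ) : picard G x n 0 = x := by
  cases n <;> simp [picard]

theorem contDiff_picard {N : ℕ} (hG : ContDiff ℝ N G) (n : ℕ) :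
    ContDiff ℝ N (picard G x n) := by
  induction n with
  | zero => exact contDiff_const
  | succ n ih => exact contDiff_const.add (contDiff_id.smul (hG.comp ih))

theorem iteratedDeriv_picard_succ {n i N : ℕ} (hG : ContDiff ℝ N G) (hi : i + 1 ≤ N) (t : ℝ) :
    iteratedDeriv (i + 1) (picard G x (n + 1)) t =
      t • iteratedDeriv (i + 1) (fun r => G (picard G x n r)) t +
        (i + 1) • iteratedDeriv i (fun r => G (picard G x n r)) t := by
  rw [← iteratedDeriv_id_smul i
    (f := fun r => G (picard G x n r))
    ((hG.comp (contDiff_picard hG n)).of_le (by exact_mod_cast hi))]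
  exact iteratedDeriv_const_add i.succ_pos x

theorem iteratedDeriv_picard_zero {N : ℕ} (hG : ContDiff ℝ N G) (n l : ℕ) (hn : l < n)
    (hN : l < N) :
    iteratedDeriv (l + 1) (picard G x n) 0 = usum (ftaylorSeries ℝ G x) l := by
  induction n generalizing l with
  | zero => omega
  | succ n ih =>
    rw [iteratedDeriv_picard_succ hG hN, zero_smul, zero_add, usum_eq,
      iteratedDeriv_comp_eq_wsum l ((contDiff_picard hG n).of_le (by exact_mod_cast hN.le))
        (fun j hj => ih j (by omega) (by omega)) (hG.of_le (by exact_mod_cast hN.le)),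
      picard_at_zero]

variable {N : ℕ} {ε : ℝ}

theorem picard_mem (hε : ε ≤ 1)
    (hb : ∀ i ≤ N, ∀ y ∈ Metric.closedBall x 1, ‖iteratedFDeriv ℝ i G y‖ ≤ ε) (n : ℕ) {t : ℝ}
    (ht : t ∈ Set.Icc (0 : ℝ) 1) : picard G x n t ∈ Metric.closedBall x 1 := by
  induction n with
  | zero => simp [picard]
  | succ n ih =>
    have h := hb 0 (Nat.zero_le _) _ ih
    rw [norm_iteratedFDeriv_zero] at h
    rw [mem_closedBall_iff_norm, picard, add_sub_cancel_left, norm_smul, Real.norm_eq_abs,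
      abs_of_nonneg ht.1]
    exact mul_le_one₀ ht.2 (norm_nonneg _) (h.trans hε)

theorem norm_iteratedDeriv_comp_picard_le {Y : Type} [NormedAddCommGroup Y]
    [NormedSpace ℝ Y] {φ : X → Y} (hφ : ContDiff ℝ N φ) (hG : ContDiff ℝ N G) (hε : ε ≤ 1)
    (hb : ∀ i ≤ N, ∀ y ∈ Metric.closedBall x 1, ‖iteratedFDeriv ℝ i G y‖ ≤ ε) {K D : ℝ}
    (hK : ∀ i ≤ N, ∀ y ∈ Metric.closedBall x 1, ‖iteratedFDeriv ℝ i φ y‖ ≤ K) {n : ℕ} {t : ℝ}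
    (ht : t ∈ Set.Icc (0 : ℝ) 1)
    (hD : ∀ i, 1 ≤ i → i ≤ N → ‖iteratedDeriv i (picard G x n) t‖ ≤ D ^ i) {i : ℕ}
    (hi : i ≤ N) :
    ‖iteratedDeriv i (fun r => φ (picard G x n r)) t‖ ≤ N.factorial * K * D ^ i := by
  have hmem := picard_mem hε hb n ht
  have hK0 : 0 ≤ K := (norm_nonneg _).trans (hK 0 (Nat.zero_le _) _ hmem)
  have hDi : 0 ≤ D ^ i := by
    rcases Nat.eq_zero_or_pos i with rfl | h
    · simp
    · exact (norm_nonneg _).trans (hD i h hi)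
  have h := norm_iteratedFDeriv_comp_le (𝕜 := ℝ) (g := φ) (f := picard G x n) (n := i) (N := N)
    hφ (contDiff_picard hG n) (by exact_mod_cast hi) t
    (fun j hj => hK j (hj.trans hi) _ hmem)
    (fun j hj hj' => by
      rw [norm_iteratedFDeriv_eq_norm_iteratedDeriv]
      exact hD j hj (hj'.trans hi))
  rw [norm_iteratedFDeriv_eq_norm_iteratedDeriv] at h
  refine h.trans ?_
  gcongr

theorem norm_iteratedDeriv_picard_le (hG : ContDiff ℝ N G) (hε0 : 0 ≤ ε) (hε : ε ≤ 1)
    (hb : ∀ i ≤ N, ∀ y ∈ Metric.closedBall x 1, ‖iteratedFDeriv ℝ i G y‖ ≤ ε) (n i : ℕ)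
    (hi : 1 ≤ i) (hiN : i ≤ N) {t : ℝ} (ht : t ∈ Set.Icc (0 : ℝ) 1) :
    ‖iteratedDeriv i (picard G x n) t‖ ≤ ((N.factorial * (N + 1) : ℝ) ^ n * ε) ^ i := by
  induction n generalizing i with
  | zero =>
    have : picard G x 0 = fun _ => x := rfl
    rw [this, iteratedDeriv_const, if_neg (by omega), norm_zero]
    positivity
  | succ n ih =>
    obtain ⟨i, rfl⟩ : ∃ j, i = j + 1 := ⟨i - 1, by omega⟩
    set Q : ℝ := N.factorial * (N + 1) with hQ
    have hfac : (1 : ℝ) ≤ N.factorial := by exact_mod_cast N.factorial_pos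
    have hQ1 : 1 ≤ Q := by nlinarith [(Nat.cast_nonneg N : (0 : ℝ) ≤ N)]
    have hQn : 1 ≤ Q ^ n := one_le_pow₀ hQ1
    have key := fun j (hj : j ≤ N) => norm_iteratedDeriv_comp_picard_le (φ := G) hG hG hε hb hb
      (n := n) ht (fun i h1 h2 => ih i h1 h2) hj
    rw [iteratedDeriv_picard_succ hG hiN]
    have e1 : ‖t • iteratedDeriv (i + 1) (fun r => G (picard G x n r)) t‖ ≤
        N.factorial * (Q ^ n * ε) ^ (i + 1) := by
      rw [norm_smul, Real.norm_eq_abs, abs_of_nonneg ht.1]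
      calc t * _ ≤ 1 * (N.factorial * ε * (Q ^ n * ε) ^ (i + 1)) := by
            gcongr
            · exact ht.2
            · exact key _ hiN
        _ ≤ 1 * (N.factorial * 1 * (Q ^ n * ε) ^ (i + 1)) := by gcongr
        _ = _ := by ring
    have e2 : ‖(i + 1) • iteratedDeriv i (fun r => G (picard G x n r)) t‖ ≤
        N * N.factorial * (Q ^ n * ε) ^ (i + 1) := by
      rw [← Nat.cast_smul_eq_nsmul ℝ, norm_smul, Real.norm_natCast]
      calc ((i + 1 : ℕ) : ℝ) * _ ≤ N * (N.factorial * ε * (Q ^ n * ε) ^ i) := by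
            gcongr
            exact key _ (by omega)
        _ ≤ N * (N.factorial * (Q ^ n * ε) * (Q ^ n * ε) ^ i) := by
            gcongr
            nlinarith
        _ = _ := by ring
    calc _ ≤ _ := (norm_add_le _ _).trans (add_le_add e1 e2)
      _ = Q * (Q ^ n * ε) ^ (i + 1) := by rw [hQ]; ring
      _ ≤ Q ^ (i + 1) * (Q ^ n * ε) ^ (i + 1) := by
          gcongr
          exact le_self_pow₀ hQ1 (by omega)
      _ = _ := by rw [← mul_pow]; ring

theorem norm_sub_picard_one_le (hG : ContDiff ℝ N G) (hN : 1 ≤ N) (hε0 : 0 ≤ ε) (hε : ε ≤ 1)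
    (hb : ∀ i ≤ N, ∀ y ∈ Metric.closedBall x 1, ‖iteratedFDeriv ℝ i G y‖ ≤ ε) {H : X}
    (hH : H = x + G H) (hHx : ‖H - x‖ ≤ 1) (n : ℕ) : ‖H - picard G x n 1‖ ≤ ε ^ n := by
  induction n with
  | zero => simpa [picard] using hHx
  | succ n ih =>
    have h1 : H - picard G x (n + 1) 1 = G H - G (picard G x n 1) := by
      conv_lhs => rw [hH]
      simp [picard]
    rw [h1, pow_succ']
    refine (Convex.norm_image_sub_le_of_norm_fderiv_le (𝕜 := ℝ) (C := ε)
      (fun y _ => hG.differentiable (by norm_cast; omega) y) (fun y hy => ?_)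
      (convex_closedBall x 1) (picard_mem hε hb n ⟨zero_le_one, le_rfl⟩)
      (mem_closedBall_iff_norm.mpr hHx)).trans (by gcongr)
    rw [← norm_iteratedFDeriv_one]
    exact hb 1 hN y hy

/-- Taylor expansion of a functional of a solution of `H = x + G H` for small `G`. -/
theorem abs_sub_sum_wsum_le {n : ℕ} (hG : ContDiff ℝ (n + 1 : ℕ) G) {φ : X → ℝ}
    (hφ : ContDiff ℝ (n + 1 : ℕ) φ) (hε0 : 0 ≤ ε) (hε : ε ≤ 1)
    (hb : ∀ i ≤ n + 1, ∀ y ∈ Metric.closedBall x 1, ‖iteratedFDeriv ℝ i G y‖ ≤ ε) {K : ℝ}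
    (hK : ∀ i ≤ n + 1, ∀ y ∈ Metric.closedBall x 1, ‖iteratedFDeriv ℝ i φ y‖ ≤ K) {H : X}
    (hH : H = x + G H) (hHx : ‖H - x‖ ≤ 1) :
    |φ H - ∑ l ∈ range (n + 1),
      wsum (usum (ftaylorSeries ℝ G x)) l (ftaylorSeries ℝ φ x) / l.factorial| ≤
      K * (1 + (n + 1).factorial *
        (((n + 1).factorial * ((n + 1 : ℕ) + 1) : ℝ) ^ (n + 1)) ^ (n + 1)) * ε ^ (n + 1) := by
  set h := picard G x (n + 1) with hh
  have hc : ContDiff ℝ (n + 1 : ℕ) h := contDiff_picard hG _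
  have hcφ : ContDiff ℝ (n + 1 : ℕ) (fun r => φ (h r)) := hφ.comp hc
  have h01 : (1 : ℝ) ∈ Set.Icc (0 : ℝ) 1 := ⟨zero_le_one, le_rfl⟩
  have h00 : (0 : ℝ) ∈ Set.Icc (0 : ℝ) 1 := ⟨le_rfl, zero_le_one⟩
  have hu := uniqueDiffOn_Icc (zero_lt_one' ℝ)
  have hK0 : 0 ≤ K := (norm_nonneg _).trans (hK 0 (Nat.zero_le _) x (by simp))
  have e1 : ‖φ H - φ (h 1)‖ ≤ K * ε ^ (n + 1) := by
    refine (Convex.norm_image_sub_le_of_norm_fderiv_le (𝕜 := ℝ) (C := K)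
      (fun y _ => hφ.differentiable (by simp) y) (fun y hy => ?_)
      (convex_closedBall x 1) (picard_mem hε hb (n + 1) h01)
      (mem_closedBall_iff_norm.mpr hHx)).trans ?_
    · rw [← norm_iteratedFDeriv_one]
      exact hK 1 (by omega) y hy
    · gcongr
      exact norm_sub_picard_one_le hG (by omega) hε0 hε hb hH hHx _
  have hwithin : ∀ j ≤ n + 1, ∀ r ∈ Set.Icc (0 : ℝ) 1,
      iteratedDerivWithin j (fun r => φ (h r)) (Set.Icc 0 1) r =
        iteratedDeriv j (fun r => φ (h r)) r := fun j hj r hr =>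
    iteratedDerivWithin_eq_iteratedDeriv hu
      (hcφ.contDiffAt.of_le (by exact_mod_cast hj)) hr
  have e2 := taylor_mean_remainder_bound (f := fun r => φ (h r)) (a := 0) (b := 1) (n := n)
    (C := (n + 1).factorial * K * (((n + 1).factorial * ((n + 1 : ℕ) + 1) : ℝ) ^ (n + 1) * ε) ^
      (n + 1)) zero_le_one (by exact_mod_cast hcφ.contDiffOn) h01 (fun y hy => by
        rw [hwithin _ le_rfl y hy]
        exact norm_iteratedDeriv_comp_picard_le hφ hG hε hb hK hy
          (fun i h1 h2 => norm_iteratedDeriv_picard_le hG hε0 hε hb _ i h1 h2 hy) le_rfl)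
  have e3 : taylorWithinEval (fun r => φ (h r)) n (Set.Icc 0 1) 0 1 = ∑ l ∈ range (n + 1),
      wsum (usum (ftaylorSeries ℝ G x)) l (ftaylorSeries ℝ φ x) / l.factorial := by
    rw [taylor_within_apply]
    refine sum_congr rfl fun l hl => ?_
    have hl' := mem_range.mp hl
    have hle : (l : WithTop ℕ∞) ≤ (n + 1 : ℕ) := by exact_mod_cast hl'.le
    rw [hwithin l hl'.le 0 h00, iteratedDeriv_comp_eq_wsum l (hc.of_le hle)
      (fun j hj => iteratedDeriv_picard_zero hG (n + 1) j (by omega) (by omega))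
      (hφ.of_le hle), hh, picard_at_zero]
    simp [div_eq_inv_mul]
  rw [e3] at e2
  have e4 : ∀ c : ℝ, 0 ≤ c → c * (1 - 0) ^ (n + 1) / n.factorial ≤ c := fun c hc => by
    rw [sub_zero, one_pow, mul_one]
    exact div_le_self hc (by exact_mod_cast n.factorial_pos)
  refine (abs_sub_le _ (φ (h 1)) _).trans ((add_le_add e1 (e2.trans (e4 _ ?_))).trans_eq ?_)
  · positivity
  · rw [mul_pow]; ring

end Picard

/-- A continuous path of solutions of `S t = x + G t (S t)` starting at `x` cannot leave the
unit ball around `x` if `G t` is small on it. -/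
theorem norm_sub_le_one_of_path {E : Type} [NormedAddCommGroup E] {x : E} {S : ℝ → E}
    {G : ℝ → E → E}
    (hc : ContinuousOn S (Set.Icc 0 1)) (h0 : S 0 = x)
    (hs : ∀ t ∈ Set.Icc (0 : ℝ) 1, S t = x + G t (S t))
    (hb : ∀ t ∈ Set.Icc (0 : ℝ) 1, ∀ y ∈ Metric.closedBall x 1, ‖G t y‖ < 1) :
    ‖S 1 - x‖ ≤ 1 := by
  by_contra! h
  have hcn : ContinuousOn (fun t => ‖S t - x‖) (Set.Icc 0 1) :=
    (hc.sub continuousOn_const).norm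
  obtain ⟨t, ht, h1⟩ := intermediate_value_Icc zero_le_one hcn
    (show (1 : ℝ) ∈ Set.Icc ‖S 0 - x‖ ‖S 1 - x‖ by simp [h0, h.le])
  have h2 := hb t ht (S t) (mem_closedBall_iff_norm.mpr (le_of_eq h1))
  have h3 := hs t ht
  rw [← sub_eq_iff_eq_add'] at h3
  rw [← h3] at h2
  exact h2.ne h1

section Series

variable {X W : Type} [NormedAddCommGroup X] [NormedSpace ℝ X] [NormedAddCommGroup W]
  [NormedSpace ℝ W]

theorem plug_add_right (v : X) (q q' : FormalMultilinearSeries ℝ X W) :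
    plug v (q + q') = plug v q + plug v q' := rfl

theorem plug_smul_right (v : X) (r : ℝ) (q : FormalMultilinearSeries ℝ X W) :
    plug v (r • q) = r • plug v q := rfl

/-- `plug` as a linear map in the inserted vector. -/
def plugₗ (q : FormalMultilinearSeries ℝ X W) : X →ₗ[ℝ] FormalMultilinearSeries ℝ X W where
  toFun v := plug v q
  map_add' v w := funext fun k => map_add (q (k + 1)).curryLeft v w
  map_smul' r v := funext fun k => map_smul (q (k + 1)).curryLeft r v

/-- `wsum` as a linear map in the series. -/
def wsumₗ (u : ℕ → X) (l : ℕ) : FormalMultilinearSeries ℝ X W →ₗ[ℝ] W where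
  toFun := wsum u l
  map_add' q q' := by
    induction l using Nat.strong_induction_on generalizing q q' with
    | _ l ih =>
      cases l with
      | zero => simp [wsum_zero]
      | succ l =>
        simp only [wsum_succ, plug_add_right, ← sum_add_distrib, ← smul_add]
        exact sum_congr rfl fun n _ => by rw [ih (l - n) (by omega)]
  map_smul' r q := by
    induction l using Nat.strong_induction_on generalizing q with
    | _ l ih =>
      cases l with
      | zero => simp [wsum_zero]
      | succ l =>
        simp only [wsum_succ, plug_smul_right, smul_sum, RingHom.id_apply] at ih ⊢
        exact sum_congr rfl fun n _ => by rw [ih (l - n) (by omega), smul_comm]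

theorem norm_plug_le (v : X) (q : FormalMultilinearSeries ℝ X W) (k : ℕ) :
    ‖plug v q k‖ ≤ ‖q (k + 1)‖ * ‖v‖ := by
  rw [← ContinuousMultilinearMap.curryLeft_norm]
  exact (q (k + 1)).curryLeft.le_opNorm v

end Series

/-- A fuel recursion in which each node only depends on larger ones is stationary. -/
theorem fuel_eq {L : ℕ} {α : Type} {step : (Fin L → α) → Fin L → α}
    (hstep : ∀ V V' i, (∀ j > i, V j = V' j) → step V i = step V' i) {aux : ℕ → Fin L → α}
    (haux : ∀ n i, aux (n + 1) i = step (aux n) i) (i : Fin L) : aux L i = step (aux L) i := by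
  have h : ∀ n n' (i : Fin L), L - i ≤ n → L - i ≤ n' → aux n i = aux n' i := by
    intro n
    induction n with
    | zero => intro n' i h; omega
    | succ n ih =>
      intro n' i h h'
      obtain ⟨n', rfl⟩ : ∃ k, n' = k + 1 := ⟨n' - 1, by omega⟩
      rw [haux, haux]
      exact hstep _ _ i fun j hj => ih n' j (by omega) (by omega)
  rw [← haux]
  exact h _ _ i (by omega) (by omega)

section Forest

variable {L : ℕ} {Cl : Type}

/-- Sons in `A` of the node with label `v`, where `f` gives fathers and colours. -/
def sons (f : Fin L → Fin (L + 1) × Cl) (A : Finset (Fin L)) (v : Fin (L + 1)) :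
    Finset (Fin L) :=
  A.filter fun j => (f j).1 = v ∧ v.val ≤ j.val

theorem mem_sons {f : Fin L → Fin (L + 1) × Cl} {A : Finset (Fin L)} {v : Fin (L + 1)}
    {j : Fin L} : j ∈ sons f A v ↔ j ∈ A ∧ (f j).1 = v ∧ v.val ≤ j.val := by
  simp [sons]

theorem lt_of_mem_sons {f : Fin L → Fin (L + 1) × Cl} {A : Finset (Fin L)} {i j : Fin L}
    (h : j ∈ sons f A i.succ) : i < j := by
  have := (mem_sons.mp h).2.2
  rw [Fin.val_succ] at this
  exact Fin.lt_def.mpr (by omega)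

variable {X W : Type} [NormedAddCommGroup X] [NormedSpace ℝ X] [NormedAddCommGroup W]
  [NormedSpace ℝ W]

/-- Evaluation of a series at the vectors `V j`, `j ∈ S`, in increasing order. -/
def ev (q : FormalMultilinearSeries ℝ X W) (S : Finset (Fin L)) (V : Fin L → X) : W :=
  q S.card fun p => V (S.orderEmbOfFin rfl p)

theorem ev_eq (q : FormalMultilinearSeries ℝ X W) {S : Finset (Fin L)} (V : Fin L → X) {k : ℕ}
    (hk : S.card = k) {e : Fin k → Fin L} (he : StrictMono e) (hm : ∀ p, e p ∈ S) :
    ev q S V = q k fun p => V (e p) := by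
  subst hk
  rw [ev, ← orderEmbOfFin_unique rfl hm he]

theorem ev_congr {q : FormalMultilinearSeries ℝ X W} {S : Finset (Fin L)} {V V' : Fin L → X}
    (h : ∀ j ∈ S, V j = V' j) : ev q S V = ev q S V' := by
  unfold ev
  congr 1
  exact funext fun p => h _ (orderEmbOfFin_mem S rfl p)

theorem ev_empty (q : FormalMultilinearSeries ℝ X W) (V : Fin L → X) : ev q ∅ V = q 0 0 := by
  rw [ev_eq q V (k := 0) rfl (e := Fin.elim0) (fun i => i.elim0) fun i => i.elim0]
  congr 1
  exact Subsingleton.elim _ _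

theorem ev_insert (q : FormalMultilinearSeries ℝ X W) {S : Finset (Fin L)} (V : Fin L → X)
    {m : Fin L} (h : ∀ j ∈ S, m < j) : ev q (insert m S) V = ev (plug (V m) q) S V := by
  have hm : m ∉ S := fun hm => lt_irrefl _ (h m hm)
  rw [ev_eq q V (card_insert_of_notMem hm) (e := Fin.cons m (S.orderEmbOfFin rfl))]
  · rw [ev, plug, ContinuousMultilinearMap.curryLeft_apply]
    congr 1
    ext p
    refine Fin.cases ?_ (fun p => ?_) p <;> simp
  · intro p p' hp
    induction p using Fin.cases with
    | zero =>
      induction p' using Fin.cases with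
      | zero => exact absurd hp (lt_irrefl _)
      | succ p' => simpa using h _ (orderEmbOfFin_mem S rfl p')
    | succ p =>
      induction p' using Fin.cases with
      | zero => exact absurd hp (Fin.not_lt_zero _)
      | succ p' => simpa using hp
  · intro p
    refine Fin.cases ?_ (fun p => ?_) p
    · simp
    · simp [orderEmbOfFin_mem]

/-- Subtree sizes, with fuel. -/
def szAux (f : Fin L → Fin (L + 1) × Cl) (A : Finset (Fin L)) : ℕ → Fin L → ℕ
  | 0, _ => 0
  | n + 1, i => 1 + ∑ c ∈ sons f A i.succ, szAux f A n c

/-- Number of nodes in `A` of the subtree rooted at `i`. -/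
def sz (f : Fin L → Fin (L + 1) × Cl) (A : Finset (Fin L)) (i : Fin L) : ℕ := szAux f A L i

theorem sz_eq (f : Fin L → Fin (L + 1) × Cl) (A : Finset (Fin L)) (i : Fin L) :
    sz f A i = 1 + ∑ c ∈ sons f A i.succ, sz f A c :=
  fuel_eq (step := fun V i => 1 + ∑ c ∈ sons f A i.succ, V c)
    (fun V V' i h => by
      rw [sum_congr rfl fun c hc => h c (lt_of_mem_sons hc)])
    (fun _ _ => rfl) i

/-- Values of subtrees, with fuel. -/
def nvAux (G : Cl → FormalMultilinearSeries ℝ X X) (f : Fin L → Fin (L + 1) × Cl)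
    (A : Finset (Fin L)) : ℕ → Fin L → X
  | 0, _ => 0
  | n + 1, i => sz f A i • ev (G (f i).2) (sons f A i.succ) (nvAux G f A n)

/-- Elementary differential, times density, of the subtree rooted at `i`. -/
def nv (G : Cl → FormalMultilinearSeries ℝ X X) (f : Fin L → Fin (L + 1) × Cl)
    (A : Finset (Fin L)) (i : Fin L) : X := nvAux G f A L i

theorem nv_eq (G : Cl → FormalMultilinearSeries ℝ X X) (f : Fin L → Fin (L + 1) × Cl)
    (A : Finset (Fin L)) (i : Fin L) :
    nv G f A i = sz f A i • ev (G (f i).2) (sons f A i.succ) (nv G f A) :=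
  fuel_eq (step := fun V i => sz f A i • ev (G (f i).2) (sons f A i.succ) V)
    (fun V V' i h => by
      rw [ev_congr fun c hc => h c (lt_of_mem_sons hc)])
    (fun _ _ => rfl) i

/-- Value of the tree with root label `r` and nonroot nodes `A`. -/
def val (G : Cl → FormalMultilinearSeries ℝ X X) (q : FormalMultilinearSeries ℝ X W)
    (r : Fin (L + 1)) (A : Finset (Fin L)) (f : Fin L → Fin (L + 1) × Cl) : W :=
  ev q (sons f A r) (nv G f A)

theorem rec_down {P : Fin L → Prop} (h : ∀ i, (∀ j > i, P j) → P i) (i : Fin L) : P i := by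
  have : ∀ n (i : Fin L), L - i ≤ n → P i := by
    intro n
    induction n with
    | zero => intro i hi; omega
    | succ n ih => exact fun i hi => h i fun j hj => ih j (by omega)
  exact this _ i le_rfl

theorem sz_congr {f f' : Fin L → Fin (L + 1) × Cl} {A S : Finset (Fin L)}
    (h : ∀ i ∈ S, sons f A i.succ = sons f' S i.succ) (i : Fin L) (hi : i ∈ S) :
    sz f A i = sz f' S i := by
  induction i using rec_down with
  | h i ih =>
    rw [sz_eq, sz_eq, h i hi,
      sum_congr rfl fun c hc => ih c (lt_of_mem_sons hc) (mem_sons.mp hc).1]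

theorem nv_congr {G : Cl → FormalMultilinearSeries ℝ X X} {f f' : Fin L → Fin (L + 1) × Cl}
    {A S : Finset (Fin L)} (h : ∀ i ∈ S, sons f A i.succ = sons f' S i.succ)
    (hc : ∀ i ∈ S, (f i).2 = (f' i).2) (i : Fin L) (hi : i ∈ S) : nv G f A i = nv G f' S i := by
  induction i using rec_down with
  | h i ih =>
    rw [nv_eq, nv_eq, h i hi, hc i hi, sz_congr h i hi,
      ev_congr fun c hc => ih c (lt_of_mem_sons hc) (mem_sons.mp hc).1]

theorem sons_congr {f f' : Fin L → Fin (L + 1) × Cl} {A : Finset (Fin L)}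
    (h : ∀ i ∈ A, f i = f' i) (v : Fin (L + 1)) : sons f A v = sons f' A v := by
  ext j
  rw [mem_sons, mem_sons]
  refine and_congr_right fun hj => ?_
  rw [h j hj]

theorem val_congr {G : Cl → FormalMultilinearSeries ℝ X X} {q : FormalMultilinearSeries ℝ X W}
    {r : Fin (L + 1)} {A : Finset (Fin L)} {f f' : Fin L → Fin (L + 1) × Cl}
    (h : ∀ i ∈ A, f i = f' i) : val G q r A f = val G q r A f' := by
  rw [val, val, sons_congr h r]
  exact ev_congr fun c hc => nv_congr (fun i _ => sons_congr h i.succ)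
    (fun i hi => by rw [h i hi]) c (mem_sons.mp hc).1

/-- `f` restricted to `A` is a monotonically labelled tree with root label `r`. -/
def Valid (f : Fin L → Fin (L + 1) × Cl) (r : Fin (L + 1)) (A : Finset (Fin L)) : Prop :=
  ∀ i ∈ A, (f i).1 = r ∨ ∃ j ∈ A, j < i ∧ (f i).1 = j.succ

theorem Valid.congr {f f' : Fin L → Fin (L + 1) × Cl} {r : Fin (L + 1)} {A : Finset (Fin L)}
    (h : ∀ i ∈ A, f i = f' i) (hf : Valid f r A) : Valid f' r A := fun i hi => by
  rw [← h i hi]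
  exact hf i hi

/-- The tree with root label `r` and nodes `A` is split into the subtree rooted at its smallest
node `m`, with further nodes `B`, and the remaining nodes. -/
structure Splits (f : Fin L → Fin (L + 1) × Cl) (r : Fin (L + 1)) (A : Finset (Fin L))
    (m : Fin L) (B : Finset (Fin L)) : Prop where
  sub : B ⊆ A.erase m
  root : (f m).1 = r
  left : Valid f m.succ B
  right : Valid f r (A.erase m \ B)

/-- `j` is a proper descendant of `m`. -/
inductive IsDesc (f : Fin L → Fin (L + 1) × Cl) (A : Finset (Fin L)) (m : Fin L) :
    Fin L → Prop
  | child {j : Fin L} (hj : j ∈ A) (h : (f j).1 = m.succ) : IsDesc f A m j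
  | step {j k : Fin L} (hj : j ∈ A) (h : (f j).1 = k.succ) (hk : IsDesc f A m k) :
    IsDesc f A m j

theorem IsDesc.mem {f : Fin L → Fin (L + 1) × Cl} {A : Finset (Fin L)} {m j : Fin L}
    (h : IsDesc f A m j) : j ∈ A := by
  cases h <;> assumption

variable {f : Fin L → Fin (L + 1) × Cl} {r : Fin (L + 1)} {A B : Finset (Fin L)} {m : Fin L}

theorem ne_succ_of_low (hr : ∀ i ∈ A, r.val ≤ i.val) {i : Fin L} (hi : i ∈ A) :
    i.succ ≠ r := fun h => by
  have := hr i hi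
  rw [← h, Fin.val_succ] at this
  omega

theorem exists_splits (hr : ∀ i ∈ A, r.val ≤ i.val) (hv : Valid f r A) (hm : m ∈ A)
    (hmin : ∀ i ∈ A, m ≤ i) : ∃ B, Splits f r A m B := by
  classical
  have hroot : (f m).1 = r := by
    rcases hv m hm with h | ⟨j, hj, hjm, -⟩
    · exact h
    · exact absurd (hmin j hj) (not_le.mpr hjm)
  have hmd : ¬ IsDesc f A m m := fun h => by
    cases h with
    | child _ h => exact ne_succ_of_low hr hm (h.symm.trans hroot)
    | step _ h hk => exact ne_succ_of_low hr hk.mem (h.symm.trans hroot)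
  refine ⟨(A.erase m).filter (IsDesc f A m), filter_subset _ _, hroot, fun i hi => ?_,
    fun i hi => ?_⟩
  · obtain ⟨hi, hd⟩ := mem_filter.mp hi
    cases hd with
    | child _ h => exact Or.inl h
    | @step _ k hiA h hk =>
      refine Or.inr ⟨k, mem_filter.mpr ⟨mem_erase.mpr ⟨fun e => hmd (e ▸ hk), hk.mem⟩, hk⟩, ?_, h⟩
      rcases hv i hiA with h' | ⟨j, -, hji, h'⟩
      · exact absurd (h.symm.trans h') (ne_succ_of_low hr hk.mem)
      · rwa [Fin.succ_injective _ (h.symm.trans h')]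
  · obtain ⟨hi, hd⟩ := mem_sdiff.mp hi
    have hd' : ¬ IsDesc f A m i := fun h => hd (mem_filter.mpr ⟨hi, h⟩)
    have hiA := mem_of_mem_erase hi
    rcases hv i hiA with h' | ⟨j, hj, hji, h'⟩
    · exact Or.inl h'
    · refine Or.inr ⟨j, mem_sdiff.mpr ⟨mem_erase.mpr ⟨?_, hj⟩, fun h => ?_⟩, hji, h'⟩
      · rintro rfl
        exact hd' (.child hiA h')
      · exact hd' (.step hiA h' (mem_filter.mp h).2)

namespace Splits

theorem unique (hr : ∀ i ∈ A, r.val ≤ i.val) (hm : m ∈ A) {B' : Finset (Fin L)}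
    (h : Splits f r A m B) (h' : Splits f r A m B') : B ⊆ B' := by
  intro i
  induction i using WellFoundedLT.induction with
  | ind i ih =>
    intro hi
    by_contra hi'
    have hiC := mem_sdiff.mpr ⟨h.sub hi, hi'⟩
    rcases h.left i hi with e | ⟨j, hj, hji, e⟩ <;>
      rcases h'.right i hiC with e' | ⟨k, hk, -, e'⟩
    · exact ne_succ_of_low hr hm (e.symm.trans e')
    · have := Fin.succ_injective _ (e.symm.trans e')
      subst this
      simp at hk
    · exact ne_succ_of_low hr (mem_of_mem_erase (h.sub hj)) (e.symm.trans e')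
    · have := Fin.succ_injective _ (e.symm.trans e')
      subst this
      exact (mem_sdiff.mp hk).2 (ih j hji hj)

theorem valid (hmin : ∀ i ∈ A, m ≤ i) (hm : m ∈ A)
    (h : Splits f r A m B) : Valid f r A := by
  intro i hi
  by_cases him : i = m
  · exact Or.inl (him ▸ h.root)
  by_cases hiB : i ∈ B
  · right
    rcases h.left i hiB with e | ⟨j, hj, hji, e⟩
    · exact ⟨m, hm, lt_of_le_of_ne (hmin i hi) (Ne.symm him), e⟩
    · exact ⟨j, mem_of_mem_erase (h.sub hj), hji, e⟩
  · rcases h.right i (mem_sdiff.mpr ⟨mem_erase.mpr ⟨him, hi⟩, hiB⟩) with e | ⟨j, hj, hji, e⟩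
    · exact Or.inl e
    · exact Or.inr ⟨j, mem_of_mem_erase (mem_sdiff.mp hj).1, hji, e⟩

theorem father (h : Splits f r A m B) {j : Fin L} (hj : j ∈ A) :
    (j = m ∧ (f j).1 = r) ∨
    (j ∈ B ∧ ((f j).1 = m.succ ∨ ∃ k ∈ B, (f j).1 = k.succ)) ∨
    (j ∈ A.erase m \ B ∧ ((f j).1 = r ∨ ∃ k ∈ A.erase m \ B, (f j).1 = k.succ)) := by
  by_cases hjm : j = m
  · exact Or.inl ⟨hjm, hjm ▸ h.root⟩
  by_cases hjB : j ∈ B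
  · exact Or.inr (Or.inl ⟨hjB, (h.left j hjB).imp_right fun ⟨k, hk, _, e⟩ => ⟨k, hk, e⟩⟩)
  · have hC : j ∈ A.erase m \ B := mem_sdiff.mpr ⟨mem_erase.mpr ⟨hjm, hj⟩, hjB⟩
    exact Or.inr (Or.inr ⟨hC, (h.right j hC).imp_right fun ⟨k, hk, _, e⟩ => ⟨k, hk, e⟩⟩)

theorem sons_left (hr : ∀ i ∈ A, r.val ≤ i.val) (h : Splits f r A m B) {i : Fin L}
    (hm : m ∈ A) (hi : i = m ∨ i ∈ B) : sons f A i.succ = sons f B i.succ := by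
  have hiA : i ∈ A := hi.elim (fun e => e ▸ hm) fun hi => mem_of_mem_erase (h.sub hi)
  have hiC : i ∉ A.erase m \ B := fun hC => by
    rcases hi with rfl | hi
    · simp at hC
    · exact (mem_sdiff.mp hC).2 hi
  have hne := ne_succ_of_low hr hiA
  ext j
  rw [mem_sons, mem_sons]
  refine ⟨fun ⟨hj, e, hle⟩ => ⟨?_, e, hle⟩,
    fun ⟨hj, e, hle⟩ => ⟨mem_of_mem_erase (h.sub hj), e, hle⟩⟩
  rcases h.father hj with ⟨-, e'⟩ | ⟨hjB, -⟩ | ⟨-, e' | ⟨k, hk, e'⟩⟩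
  · exact absurd (e.symm.trans e') hne
  · exact hjB
  · exact absurd (e.symm.trans e') hne
  · exact absurd (Fin.succ_injective _ (e.symm.trans e') ▸ hk) hiC

theorem sons_right (hr : ∀ i ∈ A, r.val ≤ i.val) (h : Splits f r A m B) {i : Fin L}
    (hi : i ∈ A.erase m \ B) :
    sons f A i.succ = sons f (A.erase m \ B) i.succ := by
  have hiE := (mem_sdiff.mp hi).1
  have hiB := (mem_sdiff.mp hi).2
  have hne := ne_succ_of_low hr (mem_of_mem_erase hiE)
  ext j
  rw [mem_sons, mem_sons]
  refine ⟨fun ⟨hj, e, hle⟩ => ⟨?_, e, hle⟩,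
    fun ⟨hj, e, hle⟩ => ⟨mem_of_mem_erase (mem_sdiff.mp hj).1, e, hle⟩⟩
  rcases h.father hj with ⟨-, e'⟩ | ⟨-, e' | ⟨k, hk, e'⟩⟩ | ⟨hjC, -⟩
  · exact absurd (e.symm.trans e') hne
  · exact absurd (Fin.succ_injective _ (e.symm.trans e')) (ne_of_mem_erase hiE)
  · exact absurd (Fin.succ_injective _ (e.symm.trans e') ▸ hk) hiB
  · exact hjC

theorem sons_root (hr : ∀ i ∈ A, r.val ≤ i.val) (hm : m ∈ A) (h : Splits f r A m B) :
    sons f A r = insert m (sons f (A.erase m \ B) r) := by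
  ext j
  rw [mem_insert, mem_sons, mem_sons]
  constructor
  · rintro ⟨hj, e, hle⟩
    rcases h.father hj with ⟨rfl, -⟩ | ⟨hjB, e' | ⟨k, hk, e'⟩⟩ | ⟨hjC, -⟩
    · exact Or.inl rfl
    · exact absurd (e'.symm.trans e) (ne_succ_of_low hr hm)
    · exact absurd (e'.symm.trans e) (ne_succ_of_low hr (mem_of_mem_erase (h.sub hk)))
    · exact Or.inr ⟨hjC, e, hle⟩
  · rintro (rfl | ⟨hj, e, hle⟩)
    · exact ⟨hm, h.root, hr _ hm⟩
    · exact ⟨mem_of_mem_erase (mem_sdiff.mp hj).1, e, hle⟩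

theorem card (h : Splits f r A m B) (hm : m ∈ A) :
    A.card = (B.card + 1) + (A.erase m \ B).card := by
  have h1 := card_sdiff_add_card_eq_card h.sub
  have h2 := card_erase_add_one hm
  omega

theorem low_left (h : Splits f r A m B) (hmin : ∀ i ∈ A, m ≤ i) :
    ∀ i ∈ B, m.succ.val ≤ i.val := fun i hi => by
  have h1 := mem_erase.mp (h.sub hi)
  have h2 := lt_of_le_of_ne (hmin i h1.2) (Ne.symm h1.1)
  rw [Fin.val_succ]
  exact h2

theorem low_right (hr : ∀ i ∈ A, r.val ≤ i.val) : ∀ i ∈ A.erase m \ B, r.val ≤ i.val :=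
  fun i hi => hr i (mem_of_mem_erase (mem_sdiff.mp hi).1)

end Splits

theorem sum_sz (hr : ∀ i ∈ A, r.val ≤ i.val) (hv : Valid f r A) :
    ∑ c ∈ sons f A r, sz f A c = A.card := by
  induction hA : A.card using Nat.strong_induction_on generalizing A r with
  | _ n ih =>
    subst hA
    rcases A.eq_empty_or_nonempty with rfl | hne
    · simp [sons]
    have hm := A.min'_mem hne
    have hmin : ∀ i ∈ A, A.min' hne ≤ i := fun i hi => A.min'_le i hi
    generalize A.min' hne = m at hm hmin
    obtain ⟨B, h⟩ := exists_splits hr hv hm hmin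
    have hc := h.card hm
    rw [h.sons_root hr hm, sum_insert (by simp [sons]), sz_eq, h.sons_left hr hm (Or.inl rfl),
      sum_congr rfl fun c hc => sz_congr (fun i hi => h.sons_left hr hm (Or.inr hi)) c
        (mem_sons.mp hc).1, ih _ (by omega) (h.low_left hmin) h.left rfl,
      sum_congr rfl fun c hc => sz_congr (fun i hi => h.sons_right hr hi) c (mem_sons.mp hc).1,
      ih _ (by omega) (Splits.low_right hr) h.right rfl]
    omega

theorem Splits.val_eq (G : Cl → FormalMultilinearSeries ℝ X X)
    (q : FormalMultilinearSeries ℝ X W) (hr : ∀ i ∈ A, r.val ≤ i.val) (hm : m ∈ A)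
    (hmin : ∀ i ∈ A, m ≤ i) (h : Splits f r A m B) :
    val G q r A f =
      val G (plug ((B.card + 1) • val G (G (f m).2) m.succ B f) q) r (A.erase m \ B) f := by
  have e1 : nv G f A m = (B.card + 1) • val G (G (f m).2) m.succ B f := by
    rw [nv_eq, sz_eq, val, h.sons_left hr hm (Or.inl rfl),
      sum_congr rfl fun c hc => sz_congr (fun i hi => h.sons_left hr hm (Or.inr hi)) c
        (mem_sons.mp hc).1, sum_sz (h.low_left hmin) h.left, add_comm 1]
    congr 1
    exact ev_congr fun c hc => nv_congr (fun i hi => h.sons_left hr hm (Or.inr hi))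
      (fun _ _ => rfl) c (mem_sons.mp hc).1
  rw [val, h.sons_root hr hm, ev_insert, e1, val]
  · exact ev_congr fun c hc => nv_congr (fun i hi => h.sons_right hr hi)
      (fun _ _ => rfl) c (mem_sons.mp hc).1
  · intro j hj
    have hj' := mem_erase.mp (mem_sdiff.mp (mem_sons.mp hj).1).1
    exact lt_of_le_of_ne (hmin j hj'.2) (Ne.symm hj'.1)

theorem norm_val_le (G : Cl → FormalMultilinearSeries ℝ X X) {κ : Cl → ℝ}
    (hκ : ∀ col, ∀ k ≤ L, ‖G col k‖ ≤ κ col) (q : FormalMultilinearSeries ℝ X W) {K : ℝ}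
    (hK : ∀ k ≤ A.card, ‖q k‖ ≤ K) (hr : ∀ i ∈ A, r.val ≤ i.val) (hv : Valid f r A) :
    ‖val G q r A f‖ ≤ K * ∏ i ∈ A, (L * κ (f i).2) := by
  induction hA : A.card using Nat.strong_induction_on generalizing A r W K with
  | _ n ih =>
    subst hA
    rcases A.eq_empty_or_nonempty with rfl | hne
    · rw [prod_empty, mul_one, val, sons, filter_empty, ev_empty]
      refine ((q 0).le_opNorm 0).trans ?_
      simpa using hK 0 le_rfl
    have hm := A.min'_mem hne
    have hmin : ∀ i ∈ A, A.min' hne ≤ i := fun i hi => A.min'_le i hi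
    generalize A.min' hne = m at hm hmin
    obtain ⟨B, h⟩ := exists_splits hr hv hm hmin
    have hc := h.card hm
    have hAL : A.card ≤ L := by simpa using card_le_univ A
    have hκ0 : ∀ col, 0 ≤ κ col := fun col => (norm_nonneg _).trans (hκ col 0 (Nat.zero_le _))
    have hB := ih B.card (by omega) (G (f m).2) (fun k hk => hκ _ k (by omega))
      (h.low_left hmin) h.left rfl
    set v := (B.card + 1) • val G (G (f m).2) m.succ B f with hvdef
    have hvn : ‖v‖ ≤ L * (κ (f m).2 * ∏ i ∈ B, (L * κ (f i).2)) := by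
      rw [hvdef, ← Nat.cast_smul_eq_nsmul ℝ, norm_smul, Real.norm_natCast]
      gcongr
      omega
    have hK0 : 0 ≤ K := (norm_nonneg _).trans (hK 0 (Nat.zero_le _))
    rw [h.val_eq G q hr hm hmin]
    refine (ih _ (by omega) _ (K := K * (L * (κ (f m).2 * ∏ i ∈ B, (L * κ (f i).2))))
      (fun k hk => (norm_plug_le _ _ _).trans ?_) (Splits.low_right hr) h.right rfl).trans_eq ?_
    · gcongr
      exact hK _ (by omega)
    · rw [← mul_prod_erase A _ hm, ← prod_sdiff h.sub]
      ring

end Forest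

section ForestSum

variable {L : ℕ} {Cl : Type} [Fintype Cl] [Inhabited Cl]
  {X W : Type} [NormedAddCommGroup X] [NormedSpace ℝ X] [NormedAddCommGroup W]
  [NormedSpace ℝ W]

open scoped Classical in
/-- The monotonically labelled trees with root label `r` and nonroot nodes `A`. -/
def trees (Cl : Type) [Fintype Cl] [Inhabited Cl] (r : Fin (L + 1)) (A : Finset (Fin L)) :
    Finset (Fin L → Fin (L + 1) × Cl) :=
  univ.filter fun f => Valid f r A ∧ ∀ i ∉ A, f i = default

theorem mem_trees {r : Fin (L + 1)} {A : Finset (Fin L)} {f : Fin L → Fin (L + 1) × Cl} :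
    f ∈ trees Cl r A ↔ Valid f r A ∧ ∀ i ∉ A, f i = default := by
  simp [trees]

/-- Restriction of `f` to `B`. -/
def restr (B : Finset (Fin L)) (f : Fin L → Fin (L + 1) × Cl) : Fin L → Fin (L + 1) × Cl :=
  fun i => if i ∈ B then f i else default

theorem restr_mem_trees {r : Fin (L + 1)} {B : Finset (Fin L)} {f : Fin L → Fin (L + 1) × Cl}
    (h : Valid f r B) : restr B f ∈ trees Cl r B :=
  mem_trees.mpr ⟨h.congr fun _ hi => (if_pos hi).symm, fun _ hi => if_neg hi⟩

/-- Joining two trees by an edge to the root of the first one. -/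
def graft (r : Fin (L + 1)) (m : Fin L) (B C : Finset (Fin L))
    (x : (Cl × (Fin L → Fin (L + 1) × Cl)) × (Fin L → Fin (L + 1) × Cl)) :
    Fin L → Fin (L + 1) × Cl :=
  fun i => if i = m then (r, x.1.1) else if i ∈ B then x.1.2 i else if i ∈ C then x.2 i
    else default

variable {r : Fin (L + 1)} {A B : Finset (Fin L)} {m : Fin L}

theorem sum_splits {V : Type} [AddCommMonoid V] (hm : m ∈ A) (hmin : ∀ i ∈ A, m ≤ i)
    (hB : B ⊆ A.erase m)
    (F : (Cl × (Fin L → Fin (L + 1) × Cl)) × (Fin L → Fin (L + 1) × Cl) → V)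
    (D : (Fin L → Fin (L + 1) × Cl) → Prop) [DecidablePred D]
    (hD : ∀ f, D f ↔ Splits f r A m B) :
    ∑ f ∈ (trees Cl r A).filter D, F (((f m).2, restr B f), restr (A.erase m \ B) f) =
      ∑ x ∈ (univ ×ˢ trees Cl m.succ B) ×ˢ trees Cl r (A.erase m \ B), F x := by
  set C := A.erase m \ B with hC
  have hmB : m ∉ B := fun h => (mem_erase.mp (hB h)).1 rfl
  have hmC : m ∉ C := fun h => (mem_erase.mp (mem_sdiff.mp h).1).1 rfl
  have hBC : ∀ i ∈ C, i ∉ B := fun i h => (mem_sdiff.mp h).2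
  refine sum_bij' (fun f _ => (((f m).2, restr B f), restr C f)) (fun x _ => graft r m B C x)
    ?_ ?_ ?_ ?_ ?_
  · intro f hf
    have hs := (hD f).mp (mem_filter.mp hf).2
    simp only [mem_product, mem_univ, true_and]
    exact ⟨restr_mem_trees hs.left, restr_mem_trees hs.right⟩
  · intro x hx
    simp only [mem_product, mem_univ, true_and, mem_trees] at hx
    obtain ⟨⟨h1, -⟩, h2, -⟩ := hx
    have hgB : ∀ i ∈ B, x.1.2 i = graft r m B C x i := fun i hi => by
      rw [graft, if_neg (ne_of_mem_of_not_mem hi hmB), if_pos hi]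
    have hgC : ∀ i ∈ C, x.2 i = graft r m B C x i := fun i hi => by
      rw [graft, if_neg (ne_of_mem_of_not_mem hi hmC), if_neg (hBC i hi), if_pos hi]
    have hs : Splits (graft r m B C x) r A m B :=
      ⟨hB, by simp [graft], h1.congr hgB, h2.congr hgC⟩
    refine mem_filter.mpr ⟨mem_trees.mpr ⟨hs.valid hmin hm, fun i hi => ?_⟩, (hD _).mpr hs⟩
    rw [graft, if_neg (ne_of_mem_of_not_mem hm hi).symm, if_neg fun h => hi (mem_of_mem_erase (hB h)),
      if_neg fun h => hi (mem_of_mem_erase (mem_sdiff.mp h).1)]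
  · intro f hf
    obtain ⟨hf, hs⟩ := mem_filter.mp hf
    have hs := (hD f).mp hs
    have hout := (mem_trees.mp hf).2
    ext1 i
    by_cases him : i = m
    · subst him
      simp [graft, ← hs.root]
    by_cases hiB : i ∈ B
    · simp [graft, him, hiB, restr]
    by_cases hiC : i ∈ C
    · simp [graft, him, hiB, hiC, restr]
    · rw [graft, if_neg him, if_neg hiB, if_neg hiC, hout i]
      exact fun hi => hiC (mem_sdiff.mpr ⟨mem_erase.mpr ⟨him, hi⟩, hiB⟩)
  · rintro ⟨⟨col, f1⟩, f2⟩ hx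
    simp only [mem_product, mem_univ, true_and, mem_trees] at hx
    obtain ⟨⟨-, h1⟩, -, h2⟩ := hx
    have e1 : restr B (graft r m B C ((col, f1), f2)) = f1 := by
      ext1 i
      by_cases hi : i ∈ B
      · rw [restr, if_pos hi, graft, if_neg (ne_of_mem_of_not_mem hi hmB), if_pos hi]
      · rw [restr, if_neg hi, h1 i hi]
    have e2 : restr C (graft r m B C ((col, f1), f2)) = f2 := by
      ext1 i
      by_cases hi : i ∈ C
      · rw [restr, if_pos hi, graft, if_neg (ne_of_mem_of_not_mem hi hmC), if_neg (hBC i hi),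
          if_pos hi]
      · rw [restr, if_neg hi, h2 i hi]
    rw [e1, e2]
    simp [graft]
  · intro f _
    rfl

theorem sum_val (G : Cl → FormalMultilinearSeries ℝ X X) (q : FormalMultilinearSeries ℝ X W)
    (hr : ∀ i ∈ A, r.val ≤ i.val) :
    ∑ f ∈ trees Cl r A, val G q r A f = wsum (usum (∑ col, G col)) A.card q := by
  classical
  induction hA : A.card using Nat.strong_induction_on generalizing A r W with
  | _ n ih =>
    subst hA
    rcases A.eq_empty_or_nonempty with rfl | hne
    · have : trees Cl r (∅ : Finset (Fin L)) = {fun _ => default} := by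
        ext f
        simp [mem_trees, Valid, funext_iff]
      rw [this, sum_singleton, val, sons, filter_empty, ev_empty, card_empty, wsum_zero]
    have hm := A.min'_mem hne
    have hmin : ∀ i ∈ A, A.min' hne ≤ i := fun i hi => A.min'_le i hi
    generalize A.min' hne = m at hm hmin
    set u := usum (∑ col, G col) with hu
    have hsplit : ∀ f ∈ trees Cl r A, val G q r A f = ∑ B ∈ (A.erase m).powerset,
        if Splits f r A m B then val G q r A f else 0 := fun f hf => by
      obtain ⟨B, h⟩ := exists_splits hr (mem_trees.mp hf).1 hm hmin
      rw [sum_eq_single B, if_pos h]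
      · exact fun B' _ hB' => if_neg fun h' =>
          hB' (Subset.antisymm (h'.unique hr hm h) (h.unique hr hm h'))
      · exact fun hB => absurd (mem_powerset.mpr h.sub) hB
    rw [sum_congr rfl hsplit, sum_comm]
    have hcard := card_erase_add_one hm
    have key : ∀ B ∈ (A.erase m).powerset,
        (∑ f ∈ trees Cl r A, if Splits f r A m B then val G q r A f else 0) =
          wsum u ((A.erase m).card - B.card) (plug (u B.card) q) := fun B hB => by
      have hB := mem_powerset.mp hB
      have hBc := card_sdiff_add_card_eq_card hB
      rw [← sum_filter, sum_congr rfl fun f hf => ((mem_filter.mp hf).2.val_eq G q hr hm hmin)]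
      set C := A.erase m \ B with hC
      have h1 := sum_splits hm hmin hB (fun x => val G (plug ((B.card + 1) •
        val G (G x.1.1) m.succ B x.1.2) q) r C x.2) (fun f => Splits f r A m B)
        (fun f => Iff.rfl)
      have h2 : ∀ f : Fin L → Fin (L + 1) × Cl, val G (plug ((B.card + 1) •
          val G (G (f m).2) m.succ B f) q) r C f = val G (plug ((B.card + 1) •
          val G (G (f m).2) m.succ B (restr B f)) q) r C (restr C f) := fun f => by
        rw [val_congr (f := f) (f' := restr B f) fun i hi => (if_pos hi).symm]
        exact val_congr fun i hi => (if_pos hi).symm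
      have hlow : ∀ i ∈ B, m.succ.val ≤ i.val := fun i hi => by
        have h1 := mem_erase.mp (hB hi)
        have h2 := lt_of_le_of_ne (hmin i h1.2) (Ne.symm h1.1)
        rw [Fin.val_succ]
        exact h2
      rw [sum_congr rfl fun f _ => h2 f]
      refine h1.trans ?_
      rw [sum_product]
      dsimp only
      have h3 : ∀ v : X, ∑ f ∈ trees Cl r C, val G (plug v q) r C f =
          (wsumₗ u C.card ∘ₗ plugₗ q) v := fun v =>
        ih _ (by omega) _ (Splits.low_right hr) rfl
      rw [sum_congr rfl fun x _ => h3 _, ← map_sum, sum_product]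
      dsimp only
      simp only [← smul_sum]
      rw [sum_congr rfl fun col _ => ih B.card (by omega) (G col) hlow rfl]
      have h4 : ∑ col, wsum u B.card (G col) = wsum u B.card (∑ col, G col) :=
        (map_sum (wsumₗ u B.card) G univ).symm
      rw [h4, hu, ← usum_eq, ← hu, show (A.erase m).card - B.card = C.card by omega]
      rfl
    rw [sum_congr rfl key,
      sum_powerset_apply_card (fun n => wsum u ((A.erase m).card - n) (plug (u n) q)),
      ← hcard, wsum_succ]

end ForestSum

section Trees

variable {l : ℕ}

/-- Fathers and colours of a tree. -/
def STree.data (t : STree l m) (i : Fin l) : Fin (l + 1) × Option (Fin m) :=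
  (t.father i, t.color i)

theorem STree.sons_data (t : STree l m) (v : Fin (l + 1)) : sons t.data univ v = t.child v := by
  ext j
  simp only [mem_sons, STree.data, STree.child, mem_univ, true_and, mem_filter]
  exact ⟨fun h => h.1, fun h => ⟨h, h ▸ t.mono j⟩⟩

theorem STree.lt_of_mem_child {t : STree l m} {i j : Fin l} (h : j ∈ t.child i.succ) : i < j := by
  rw [← t.sons_data] at h
  exact lt_of_mem_sons h

theorem STree.sz_data (t : STree l m) (i : Fin l) : sz t.data univ i = t.size i := by
  have h : ∀ n i, szAux t.data univ n i = sizeAux t n i := by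
    intro n
    induction n with
    | zero => exact fun i => rfl
    | succ n ih =>
      intro i
      simp only [szAux, sizeAux, t.sons_data, ih]
  exact h l i

theorem STree.data_mem_trees (t : STree l m) : t.data ∈ trees (Option (Fin m)) 0 univ := by
  refine mem_trees.mpr ⟨fun i _ => ?_, fun i hi => absurd (mem_univ i) hi⟩
  rcases Fin.eq_zero_or_eq_succ (t.father i) with h | ⟨j, h⟩
  · exact Or.inl h
  · refine Or.inr ⟨j, mem_univ j, ?_, h⟩
    have := t.mono i
    rw [h, Fin.val_succ] at this
    exact Fin.lt_def.mpr this

theorem STree.sum_data {V : Type} [AddCommMonoid V]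
    (F : (Fin l → Fin (l + 1) × Option (Fin m)) → V) :
    ∑ t : STree l m, F t.data = ∑ f ∈ trees (Option (Fin m)) 0 univ, F f := by
  refine sum_bij (fun t _ => t.data) (fun t _ => t.data_mem_trees) ?_ ?_ fun _ _ => rfl
  · rintro ⟨fa, co, _⟩ _ ⟨fa', co', _⟩ _ h
    have h1 : fa = fa' := funext fun i => congrArg Prod.fst (congrFun h i)
    have h2 : co = co' := funext fun i => congrArg Prod.snd (congrFun h i)
    subst h1 h2
    rfl
  · intro f hf
    refine ⟨⟨fun i => (f i).1, fun i => (f i).2, fun i => ?_⟩, mem_univ _, rfl⟩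
    rcases (mem_trees.mp hf).1 i (mem_univ i) with h | ⟨j, -, hj, h⟩
    · simp [h]
    · rw [h, Fin.val_succ]
      exact hj

theorem STree.densNode_eq (t : STree l m) (i : Fin l) :
    t.densNode i = t.size i * ∏ c ∈ t.child i.succ, t.densNode c :=
  fuel_eq (step := fun V i => t.size i * ∏ c ∈ t.child i.succ, V c)
    (fun V V' i h => by
      rw [prod_congr rfl fun c hc => h c (lt_of_mem_child hc)])
    (fun _ _ => rfl) i

theorem elemF_eq (a : Evec d → Evec d) (b : Fin m → Evec d → Evec d) (t : STree l m)
    (i : Fin l) (x : Evec d) :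
    elemF a b t i x = ev (ftaylorSeries ℝ (nodeFun a b (t.color i)) x) (t.child i.succ)
      fun j => elemF a b t j x :=
  congrFun (fuel_eq (step := fun (V : Fin l → Evec d → Evec d) i => fun x =>
      ev (ftaylorSeries ℝ (nodeFun a b (t.color i)) x) (t.child i.succ) fun j => V j x)
    (fun V V' i h => funext fun x => by
      rw [ev_congr fun c hc => congrFun (h c (STree.lt_of_mem_child hc)) x])
    (fun _ _ => rfl) i) x

theorem elemFRoot_eq (f : Evec d → ℝ) (a : Evec d → Evec d) (b : Fin m → Evec d → Evec d)
    (t : STree l m) (x : Evec d) :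
    elemFRoot f a b t x = ev (ftaylorSeries ℝ f x) (t.child 0) fun j => elemF a b t j x := rfl

/-- Colour of the nodes to which an index pair belongs. -/
def SIdx.color : SIdx m M → Option (Fin m)
  | .det => none
  | .sto r _ => some r

/-- Index pairs as an option type. -/
def SIdx.equiv (m : ℕ) (M : Type) : SIdx m M ≃ Option (Fin m × M) where
  toFun
    | .det => none
    | .sto r μ => some (r, μ)
  invFun
    | none => .det
    | some x => .sto x.1 x.2
  left_inv p := by cases p <;> rfl
  right_inv p := by cases p <;> rfl

instance [Fintype M] : Fintype (SIdx m M) := Fintype.ofEquiv _ (SIdx.equiv m M).symm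

variable [Fintype M]

theorem SIdx.sum_eq {V : Type} [AddCommMonoid V] (F : SIdx m M → V) :
    ∑ κ, F κ = F .det + ∑ r, ∑ μ, F (.sto r μ) := by
  rw [← (SIdx.equiv m M).symm.sum_comp, Fintype.sum_option, Fintype.sum_prod_type]
  rfl

theorem SIdx.sum_color_none {V : Type} [AddCommMonoid V] (F : SIdx m M → V) :
    ∑ κ : SIdx m M, (if κ.color = none then F κ else 0) = F .det := by
  simp [SIdx.sum_eq, SIdx.color]

theorem SIdx.sum_color_some {V : Type} [AddCommMonoid V] (r : Fin m) (F : SIdx m M → V) :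
    ∑ κ : SIdx m M, (if κ.color = some r then F κ else 0) = ∑ μ, F (.sto r μ) := by
  simp only [SIdx.sum_eq, SIdx.color, reduceCtorEq, if_false, zero_add, Option.some.injEq]
  rw [sum_eq_single r]
  · simp
  · intro r' _ h
    simp [h]
  · simp

/-- The coefficients of all stages (`some (p, i)`) and of the final value (`none`). -/
def SRK.coef (c : SRK m s M) (θ : Mbar M → ℝ) :
    Option (SIdx m M × Fin s) → SIdx m M → Fin s → ℝ
  | none => c.z θ
  | some (p, i) => fun κ j => c.Z θ p κ i j

/-- The weights `Ψ` of stages and `Φ` of the final value. -/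
def weight (c : SRK m s M) (θ : Mbar M → ℝ) (t : STree l m) (i : Fin l) :
    Option (SIdx m M × Fin s) → ℝ
  | none => phiFactor c θ t i
  | some (p, q) => PsiN c θ t i p q

theorem weight_eq (c : SRK m s M) (θ : Mbar M → ℝ) (t : STree l m) (i : Fin l)
    (ι : Option (SIdx m M × Fin s)) :
    weight c θ t i ι = ∑ κ : SIdx m M, ∑ j, (if κ.color = t.color i then
      c.coef θ ι κ j * ∏ cc ∈ t.child i.succ, weight c θ t cc (some (κ, j)) else 0) := by
  have h0 : ∀ κ : SIdx m M, ∑ j, (if κ.color = t.color i then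
      c.coef θ ι κ j * ∏ cc ∈ t.child i.succ, weight c θ t cc (some (κ, j)) else 0) =
      if κ.color = t.color i then
      ∑ j, c.coef θ ι κ j * ∏ cc ∈ t.child i.succ, weight c θ t cc (some (κ, j)) else 0 :=
    fun κ => by split_ifs <;> simp
  rw [sum_congr rfl fun κ _ => h0 κ]
  cases ι with
  | none =>
    rw [weight, phiFactor]
    cases hcol : t.color i with
    | none => rw [SIdx.sum_color_none]; rfl
    | some r => rw [SIdx.sum_color_some]; rfl
  | some pq =>
    obtain ⟨p, q⟩ := pq
    have h := fuel_eq (aux := PsiAux c θ t) (step := fun V i p q =>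
      match t.color i with
      | none => ∑ j, c.Z θ p .det q j * ∏ cc ∈ t.child i.succ, V cc .det j
      | some jj => ∑ μ : M, ∑ j, c.Z θ p (.sto jj μ) q j *
        ∏ cc ∈ t.child i.succ, V cc (.sto jj μ) j)
      (fun V V' i h => by
        ext p q
        have h1 : ∀ κ j, ∏ cc ∈ t.child i.succ, V cc κ j = ∏ cc ∈ t.child i.succ, V' cc κ j :=
          fun κ j => prod_congr rfl fun cc hcc => by rw [h cc (STree.lt_of_mem_child hcc)]
        simp only [h1])
      (fun _ _ => rfl) i
    rw [weight, PsiN, h]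
    cases hcol : t.color i with
    | none => rw [SIdx.sum_color_none]; rfl
    | some r => rw [SIdx.sum_color_some]; rfl

end Trees

section StageMap

variable [Fintype M]

/-- Stages and final value, stacked. -/
abbrev Stack (d m s : ℕ) (M : Type) : Type := Option (SIdx m M × Fin s) → Evec d

/-- The part of the stacked right-hand side with coefficient function `g` and colour `col`. -/
def stageMap (c : SRK m s M) (θ : Mbar M → ℝ) (g : Option (Fin m) → Evec d → Evec d)
    (col : Option (Fin m)) (S : Stack d m s M) : Stack d m s M :=
  fun ι => ∑ κ : SIdx m M, ∑ j, (if κ.color = col then c.coef θ ι κ j else 0) •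
    g col (S (some (κ, j)))

variable {c : SRK m s M} {θ : Mbar M → ℝ} {g : Option (Fin m) → Evec d → Evec d}
  {col : Option (Fin m)}

theorem sum_stageMap (S : Stack d m s M) (ι : Option (SIdx m M × Fin s)) :
    (∑ col, stageMap c θ g col S) ι =
      ∑ κ : SIdx m M, ∑ j, c.coef θ ι κ j • g κ.color (S (some (κ, j))) := by
  simp only [Finset.sum_apply, stageMap]
  rw [sum_comm]
  refine sum_congr rfl fun κ _ => ?_
  rw [sum_comm]
  refine sum_congr rfl fun j _ => ?_
  simp [ite_smul]

theorem contDiff_stageMap {n : WithTop ℕ∞} (hg : ContDiff ℝ n (g col)) :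
    ContDiff ℝ n (stageMap c θ g col) := by
  refine contDiff_pi.mpr fun ι => ContDiff.sum fun κ _ => ContDiff.sum fun j _ => ?_
  exact ContDiff.const_smul _ (f := fun S : Stack d m s M => g col (S (some (κ, j))))
    (hg.comp (contDiff_apply ℝ (Evec d) (some (κ, j))))

theorem iteratedFDeriv_comp_apply {ι : Type} [Fintype ι] {E F : Type} [NormedAddCommGroup E]
    [NormedSpace ℝ E] [NormedAddCommGroup F] [NormedSpace ℝ F] {k : ℕ} {φ : E → F}
    (hφ : ContDiff ℝ k φ) (i : ι) (S : ι → E) (v : Fin k → ι → E) :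
    iteratedFDeriv ℝ k (fun S : ι → E => φ (S i)) S v =
      iteratedFDeriv ℝ k φ (S i) fun p => v p i := by
  have := (ContinuousLinearMap.proj (R := ℝ) (φ := fun _ : ι => E) i).iteratedFDeriv_comp_right
    hφ S le_rfl
  exact congrArg (fun q => q v) this

theorem iteratedFDeriv_stageMap {k : ℕ} (hg : ContDiff ℝ k (g col)) (S : Stack d m s M)
    (v : Fin k → Stack d m s M) (ι : Option (SIdx m M × Fin s)) :
    iteratedFDeriv ℝ k (stageMap c θ g col) S v ι =
      ∑ κ : SIdx m M, ∑ j, (if κ.color = col then c.coef θ ι κ j else 0) •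
        iteratedFDeriv ℝ k (g col) (S (some (κ, j))) fun p => v p (some (κ, j)) := by
  have h1 := (ContinuousLinearMap.proj (R := ℝ)
    (φ := fun _ : Option (SIdx m M × Fin s) => Evec d) ι).iteratedFDeriv_comp_left
    (x := S) (contDiff_stageMap (c := c) (θ := θ) hg).contDiffAt le_rfl
  have h2 := congrArg (fun q => q v) h1
  have hsm : ∀ (κ : SIdx m M) (j : Fin s), ContDiff ℝ k (fun S : Stack d m s M =>
      (if κ.color = col then c.coef θ ι κ j else 0) • g col (S (some (κ, j)))) := fun κ j =>
    ContDiff.const_smul _ (f := fun S : Stack d m s M => g col (S (some (κ, j))))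
      (hg.comp (contDiff_apply ℝ (Evec d) (some (κ, j))))
  refine (h2.symm.trans ?_ : _)
  change iteratedFDeriv ℝ k (fun S => ∑ κ : SIdx m M, ∑ j,
    (if κ.color = col then c.coef θ ι κ j else 0) • g col (S (some (κ, j)))) S v = _
  rw [iteratedFDeriv_fun_sum_apply fun κ _ => (ContDiff.sum fun j _ => hsm κ j).contDiffAt,
    _root_.sum_apply]
  refine sum_congr rfl fun κ _ => ?_
  rw [iteratedFDeriv_fun_sum_apply fun j _ => (hsm κ j).contDiffAt,
    _root_.sum_apply]
  refine sum_congr rfl fun j _ => ?_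
  rw [iteratedFDeriv_const_smul_apply' (f := fun S : Stack d m s M => g col (S (some (κ, j))))
    (hg.comp (contDiff_apply ℝ (Evec d) (some (κ, j)))).contDiffAt,
    _root_.smul_apply]
  exact congrArg _ (iteratedFDeriv_comp_apply hg _ S v)

theorem norm_iteratedFDeriv_stageMap_le {k : ℕ} (hg : ContDiff ℝ k (g col))
    (S : Stack d m s M) {K w : ℝ} (hK0 : 0 ≤ K) (hw : 0 ≤ w)
    (hK : ∀ κ j, ‖iteratedFDeriv ℝ k (g col) (S (some (κ, j)))‖ ≤ K)
    (hc : ∀ ι (κ : SIdx m M) j, κ.color = col → |c.coef θ ι κ j| ≤ w) :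
    ‖iteratedFDeriv ℝ k (stageMap c θ g col) S‖ ≤
      Fintype.card (SIdx m M) * (s * (w * K)) := by
  refine ContinuousMultilinearMap.opNorm_le_bound (by positivity) fun v => ?_
  rw [pi_norm_le_iff_of_nonneg (by positivity)]
  intro ι
  rw [iteratedFDeriv_stageMap hg]
  have h : ∀ (κ : SIdx m M) (j : Fin s), ‖(if κ.color = col then c.coef θ ι κ j else 0) •
      iteratedFDeriv ℝ k (g col) (S (some (κ, j))) fun p => v p (some (κ, j))‖ ≤
      w * K * ∏ p, ‖v p‖ := fun κ j => by
    rw [norm_smul, mul_assoc]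
    refine mul_le_mul ?_ ?_ (norm_nonneg _) hw
    · split_ifs with h
      · exact hc ι κ j h
      · simpa using hw
    · refine (ContinuousMultilinearMap.le_opNorm _ _).trans ?_
      gcongr
      · exact hK κ j
      · exact norm_le_pi_norm _ _
  calc _ ≤ ∑ κ : SIdx m M, ∑ j : Fin s, w * K * ∏ p, ‖v p‖ :=
        norm_sum_le_of_le _ fun κ _ => norm_sum_le_of_le _ fun j _ => h κ j
    _ = _ := by simp; ring

variable {a : Evec d → Evec d} {b : Fin m → Evec d → Evec d} {l : ℕ} {x0 : Evec d}

theorem nv_stageMap (hg : ∀ col, ContDiff ℝ l (nodeFun a b col)) (t : STree l m) (i : Fin l)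
    (ι : Option (SIdx m M × Fin s)) :
    nv (fun col => ftaylorSeries ℝ (stageMap c θ (nodeFun a b) col) fun _ => x0) t.data univ i ι =
      (t.densNode i * weight c θ t i ι) • elemF a b t i x0 := by
  induction i using rec_down generalizing ι with
  | h i ih =>
    have hcard : (t.child i.succ).card ≤ l := by simpa using card_le_univ (t.child i.succ)
    rw [nv_eq, t.sons_data, t.sz_data, Pi.smul_apply, ev, ftaylorSeries,
      iteratedFDeriv_stageMap ((hg _).of_le (by exact_mod_cast hcard)), t.densNode_eq,
      weight_eq, mul_sum, sum_smul, smul_sum]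
    refine sum_congr rfl fun κ _ => ?_
    rw [mul_sum, sum_smul, smul_sum]
    refine sum_congr rfl fun j _ => ?_
    change _ • (if κ.color = t.color i then _ else _) • _ = _
    split_ifs with h
    · have e1 : (fun p => nv (fun col => ftaylorSeries ℝ (stageMap c θ (nodeFun a b) col)
          fun _ => x0) t.data univ ((t.child i.succ).orderEmbOfFin rfl p) (some (κ, j))) =
          fun p => (t.densNode ((t.child i.succ).orderEmbOfFin rfl p) *
            weight c θ t ((t.child i.succ).orderEmbOfFin rfl p) (some (κ, j))) •
            elemF a b t ((t.child i.succ).orderEmbOfFin rfl p) x0 := funext fun p =>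
        ih _ (STree.lt_of_mem_child (orderEmbOfFin_mem _ _ p)) _
      have e2 : ∀ F : Fin l → ℝ, ∏ p, F ((t.child i.succ).orderEmbOfFin rfl p) =
          ∏ cc ∈ t.child i.succ, F cc := fun F => by
        conv_rhs => rw [← image_orderEmbOfFin_univ (t.child i.succ) rfl]
        rw [prod_image fun _ _ _ _ h => ((t.child i.succ).orderEmbOfFin rfl).injective h]
      rw [e1, ContinuousMultilinearMap.map_smul_univ,
        e2 fun cc => t.densNode cc * weight c θ t cc (some (κ, j)), prod_mul_distrib,
        elemF_eq, ev, ftaylorSeries, smul_smul, ← Nat.cast_smul_eq_nsmul ℝ, smul_smul]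
      congr 1
      push_cast
      ring
    · simp

theorem val_stageMap (hg : ∀ col, ContDiff ℝ l (nodeFun a b col)) {f : Evec d → ℝ}
    (hf : ContDiff ℝ l f) (t : STree l m) :
    val (fun col => ftaylorSeries ℝ (stageMap c θ (nodeFun a b) col) fun _ => x0)
      (ftaylorSeries ℝ (fun S : Stack d m s M => f (S none)) fun _ => x0) 0 univ t.data =
      t.densDelta * elemFRoot f a b t x0 * PhiS c θ t := by
  have hcard : (t.child 0).card ≤ l := by simpa using card_le_univ (t.child 0)
  have e2 : ∀ F : Fin l → ℝ, ∏ p, F ((t.child 0).orderEmbOfFin rfl p) =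
      ∏ cc ∈ t.child 0, F cc := fun F => by
    conv_rhs => rw [← image_orderEmbOfFin_univ (t.child 0) rfl]
    rw [prod_image fun _ _ _ _ h => ((t.child 0).orderEmbOfFin rfl).injective h]
  rw [val, t.sons_data, ev, ftaylorSeries,
    iteratedFDeriv_comp_apply (hf.of_le (by exact_mod_cast hcard))]
  simp only [nv_stageMap hg]
  rw [ContinuousMultilinearMap.map_smul_univ,
    e2 fun cc => t.densNode cc * weight c θ t cc none, prod_mul_distrib, smul_eq_mul,
    elemFRoot_eq, ev, ftaylorSeries, STree.densDelta, PhiS]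
  push_cast
  simp only [weight]
  ring

end StageMap

theorem usum_congr {X : Type} [NormedAddCommGroup X] [NormedSpace ℝ X]
    {g g' : FormalMultilinearSeries ℝ X X} (n : ℕ) (h : ∀ k ≤ n, g k = g' k) :
    usum g n = usum g' n := by
  induction n using Nat.strong_induction_on with
  | _ n ih =>
    rw [usum_eq, usum_eq]
    congr 1
    exact wsum_congr n (fun j hj => ih j hj fun k hk => h k (by omega)) h

theorem exists_bound_iteratedFDeriv {E F I : Type} [NormedAddCommGroup E] [NormedSpace ℝ E]
    [NormedAddCommGroup F] [NormedSpace ℝ F] [ProperSpace E] [Fintype I] {N : ℕ} {g : I → E → F}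
    (hg : ∀ i, ContDiff ℝ N (g i)) (x : E) (r : ℝ) :
    ∃ K, 0 ≤ K ∧ ∀ i, ∀ k ≤ N, ∀ y ∈ Metric.closedBall x r, ‖iteratedFDeriv ℝ k (g i) y‖ ≤ K := by
  have h : ∀ i : I, ∀ k : Fin (N + 1), ∃ K, ∀ y ∈ Metric.closedBall x r,
      ‖iteratedFDeriv ℝ k (g i) y‖ ≤ K := fun i k =>
    (isCompact_closedBall x r).exists_bound_of_continuousOn
      ((hg i).continuous_iteratedFDeriv
        (by exact_mod_cast Nat.lt_succ_iff.mp k.isLt)).continuousOn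
  choose K hK using h
  refine ⟨∑ i, ∑ k, |K i k|, sum_nonneg fun i _ => sum_nonneg fun k _ => abs_nonneg _,
    fun i k hk y hy => (hK i ⟨k, Nat.lt_succ_of_le hk⟩ y hy).trans ((le_abs_self _).trans ?_)⟩
  exact (single_le_sum (f := fun k => |K i k|) (fun k _ => abs_nonneg _) (mem_univ _)).trans
    (single_le_sum (f := fun i => ∑ k, |K i k|) (fun i _ => sum_nonneg fun k _ => abs_nonneg _)
      (mem_univ i))

section Coefficients

variable [Fintype M]

/-- Order of magnitude of the increments belonging to a colour. -/
def colorWeight (η : ℝ) : Option (Fin m) → ℝ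
  | none => η ^ 2
  | some _ => η

theorem exists_bound_coef (c : SRK m s M) (B : ℝ) : ∃ K, 0 ≤ K ∧ ∀ (θ : Mbar M → ℝ) (η : ℝ),
    0 ≤ η → |θ none| ≤ η ^ 2 → (∀ ι, |θ (some ι)| ≤ B * η) → ∀ ι (κ : SIdx m M) j,
      |c.coef θ ι κ j| ≤ K * colorWeight η κ.color := by
  have h : ∀ (ι : Option (SIdx m M × Fin s)) (κ : SIdx m M) (j : Fin s), ∃ K, 0 ≤ K ∧
      ∀ (θ : Mbar M → ℝ) (η : ℝ), 0 ≤ η → |θ none| ≤ η ^ 2 → (∀ ι, |θ (some ι)| ≤ B * η) →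
      |c.coef θ ι κ j| ≤ K * colorWeight η κ.color := by
    have hdet : ∀ x : ℝ, ∃ K, 0 ≤ K ∧ ∀ (θ : Mbar M → ℝ) (η : ℝ), 0 ≤ η → |θ none| ≤ η ^ 2 →
        (∀ ι, |θ (some ι)| ≤ B * η) → |x * θ none| ≤ K * η ^ 2 := fun x =>
      ⟨|x|, abs_nonneg _, fun θ η _ h _ => by rw [abs_mul]; gcongr⟩
    have hsto : ∀ x : M → ℝ, ∃ K, 0 ≤ K ∧ ∀ (θ : Mbar M → ℝ) (η : ℝ), 0 ≤ η →
        |θ none| ≤ η ^ 2 → (∀ ι, |θ (some ι)| ≤ B * η) →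
        |∑ ι, x ι * θ (some ι)| ≤ K * η := fun x => by
      refine ⟨∑ ι, |x ι| * |B|, sum_nonneg fun ι _ => by positivity, fun θ η hη _ h => ?_⟩
      rw [sum_mul]
      refine (abs_sum_le_sum_abs _ _).trans (sum_le_sum fun ι _ => ?_)
      rw [abs_mul, mul_assoc]
      gcongr
      exact (h ι).trans (by gcongr; exact le_abs_self B)
    intro ι κ j
    cases ι with
    | none =>
      cases κ with
      | det => exact hdet _
      | sto r μ => exact hsto _
    | some p =>
      cases κ with
      | det => exact hdet _
      | sto r μ => exact hsto _
  choose K hK0 hK using h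
  refine ⟨∑ ι, ∑ κ, ∑ j, K ι κ j, sum_nonneg fun ι _ => sum_nonneg fun κ _ =>
    sum_nonneg fun j _ => hK0 ι κ j, fun θ η hη h1 h2 ι κ j => (hK ι κ j θ η hη h1 h2).trans ?_⟩
  have hw : 0 ≤ colorWeight η κ.color := by
    cases κ with
    | det => exact sq_nonneg η
    | sto r μ => exact hη
  refine mul_le_mul_of_nonneg_right ?_ hw
  calc K ι κ j ≤ ∑ j, K ι κ j :=
        single_le_sum (f := fun j => K ι κ j) (fun j _ => hK0 ι κ j) (mem_univ j)
    _ ≤ ∑ κ, ∑ j, K ι κ j := single_le_sum (f := fun κ => ∑ j, K ι κ j)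
        (fun κ _ => sum_nonneg fun j _ => hK0 ι κ j) (mem_univ κ)
    _ ≤ _ := single_le_sum (f := fun ι => ∑ κ, ∑ j, K ι κ j)
        (fun ι _ => sum_nonneg fun κ _ => sum_nonneg fun j _ => hK0 ι κ j) (mem_univ ι)

theorem prod_colorWeight {l : ℕ} (η : ℝ) (t : STree l m) :
    ∏ i, colorWeight η (t.color i) = η ^ (2 * t.dcount + t.scount) := by
  have h : ∀ i, colorWeight η (t.color i) = if t.color i = none then η ^ 2 else η := fun i => by
    cases t.color i <;> rfl
  have hs : t.scount = (univ.filter fun i => ¬ t.color i = none).card := by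
    rw [STree.scount]
    congr 1
    ext i
    cases h : t.color i <;> simp [h]
  rw [prod_congr rfl fun i _ => h i, prod_ite, prod_const, prod_const, hs, STree.dcount, pow_add,
    pow_mul]

theorem continuous_coef (c : SRK m s M) (ι : Option (SIdx m M × Fin s)) (κ : SIdx m M)
    (j : Fin s) : Continuous fun θ => c.coef θ ι κ j := by
  cases ι <;> cases κ <;> simp only [SRK.coef, SRK.z, SRK.Z] <;> fun_prop

theorem continuous_weight (c : SRK m s M) {l : ℕ} (t : STree l m) (i : Fin l)
    (ι : Option (SIdx m M × Fin s)) : Continuous fun θ => weight c θ t i ι := by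
  induction i using rec_down generalizing ι with
  | h i ih =>
    simp only [weight_eq c _ t i]
    refine continuous_finsetSum _ fun κ _ => continuous_finsetSum _ fun j _ => ?_
    split_ifs
    · exact (continuous_coef c ι κ j).mul
        (continuous_finsetProd _ fun cc hcc => ih cc (STree.lt_of_mem_child hcc) _)
    · exact continuous_const

theorem continuous_PhiS (c : SRK m s M) {l : ℕ} (t : STree l m) :
    Continuous fun θ => PhiS c θ t :=
  continuous_finsetProd _ fun i _ => continuous_weight c t i none

/-- The stacked right-hand side of the stage equations. -/
def stageSum (c : SRK m s M) (θ : Mbar M → ℝ) (a : Evec d → Evec d) (b : Fin m → Evec d → Evec d)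
    (S : Stack d m s M) : Stack d m s M := ∑ col, stageMap c θ (nodeFun a b) col S

/-- The stages and the value of one step. -/
def stack (c : SRK m s M) (a : Evec d → Evec d) (b : Fin m → Evec d → Evec d) (x0 : Evec d)
    (θ : Mbar M → ℝ) (H : SIdx m M → Fin s → Evec d) : Stack d m s M
  | none => oneStep c a b x0 θ H
  | some (p, i) => H p i

theorem stack_eq {c : SRK m s M} {a : Evec d → Evec d} {b : Fin m → Evec d → Evec d}
    {x0 : Evec d} {θ : Mbar M → ℝ} {H : SIdx m M → Fin s → Evec d}
    (h : StageEq c a b x0 θ H) :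
    stack c a b x0 θ H = (fun _ => x0) + stageSum c θ a b (stack c a b x0 θ H) := by
  have hsum : ∀ F : Fin s → Fin m → M → Evec d,
      ∑ j, ∑ r, ∑ μ, F j r μ = ∑ r, ∑ μ, ∑ j, F j r μ := fun F => by
    rw [sum_comm]
    exact sum_congr rfl fun r _ => sum_comm
  funext ι
  rw [Pi.add_apply, stageSum, sum_stageMap, SIdx.sum_eq]
  cases ι with
  | none =>
    change x0 + (∑ i, c.z θ .det i • a (H .det i)) +
      ∑ i, ∑ k, ∑ ν, c.z θ (.sto k ν) i • b k (H (.sto k ν) i) = _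
    rw [hsum fun j r μ => c.z θ (.sto r μ) j • b r (H (.sto r μ) j), add_assoc]
    rfl
  | some p =>
    obtain ⟨p, i⟩ := p
    refine (h p i).trans ?_
    rw [hsum fun j r μ => c.Z θ p (.sto r μ) i j • b r (H (.sto r μ) j), add_assoc]
    rfl

theorem continuousOn_stack {c : SRK m s M} {a : Evec d → Evec d} {b : Fin m → Evec d → Evec d}
    {x0 : Evec d} (hab : ∀ col, Continuous (nodeFun a b col)) {T : Set ℝ} {θ : ℝ → Mbar M → ℝ}
    (hθ : Continuous θ) {H : ℝ → SIdx m M → Fin s → Evec d}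
    (hH : ∀ p i, ContinuousOn (fun t => H t p i) T) :
    ContinuousOn (fun t => stack c a b x0 (θ t) (H t)) T := by
  refine continuousOn_pi.mpr fun ι => ?_
  cases ι with
  | none =>
    have hz : ∀ κ j, ContinuousOn (fun t => c.z (θ t) κ j) T := fun κ j =>
      ((continuous_coef c none κ j).comp hθ).continuousOn
    have hn : ∀ col κ j, ContinuousOn (fun t => nodeFun a b col (H t κ j)) T := fun col κ j =>
      (hab col).comp_continuousOn (hH κ j)
    refine (continuousOn_const.add (continuousOn_finsetSum _ fun i _ =>
      (hz .det i).smul (hn none .det i))).add ?_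
    exact continuousOn_finsetSum _ fun i _ => continuousOn_finsetSum _ fun k _ =>
      continuousOn_finsetSum _ fun ν _ => (hz (.sto k ν) i).smul (hn (some k) _ i)
  | some p => exact hH p.1 p.2

end Coefficients

section Expansion

variable [Fintype M] {f : Evec d → ℝ} {a : Evec d → Evec d} {b : Fin m → Evec d → Evec d}
  {x0 : Evec d} {N : ℕ}

theorem colorWeight_nonneg {η : ℝ} (hη : 0 ≤ η) (col : Option (Fin m)) :
    0 ≤ colorWeight η col := by
  cases col with
  | none => exact sq_nonneg η
  | some _ => exact hη

theorem colorWeight_le {η : ℝ} (hη : 0 ≤ η) (hη1 : η ≤ 1) (col : Option (Fin m)) :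
    colorWeight η col ≤ η := by
  cases col with
  | none => exact (pow_le_of_le_one hη hη1 two_ne_zero)
  | some _ => exact le_rfl

theorem contDiff_stageSum {c : SRK m s M} {θ : Mbar M → ℝ} {n : WithTop ℕ∞}
    (hg : ∀ col, ContDiff ℝ n (nodeFun a b col)) : ContDiff ℝ n (stageSum c θ a b) :=
  ContDiff.sum fun col _ => contDiff_stageMap (hg col)

theorem stageSum_zero (c : SRK m s M) (S : Stack d m s M) : stageSum c 0 a b S = 0 := by
  have h : ∀ ι (κ : SIdx m M) j, c.coef 0 ι κ j = 0 := fun ι κ j => by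
    cases ι <;> cases κ <;> simp [SRK.coef, SRK.z, SRK.Z]
  funext ι
  rw [stageSum, sum_stageMap]
  simp [h]

theorem iteratedFDeriv_stageSum {c : SRK m s M} {θ : Mbar M → ℝ} {k : ℕ}
    (hg : ∀ col, ContDiff ℝ k (nodeFun a b col)) (S : Stack d m s M) :
    iteratedFDeriv ℝ k (stageSum c θ a b) S =
      ∑ col, iteratedFDeriv ℝ k (stageMap c θ (nodeFun a b) col) S :=
  iteratedFDeriv_fun_sum_apply fun col _ => (contDiff_stageMap (hg col)).contDiffAt

theorem wsum_stageSum {c : SRK m s M} {θ : Mbar M → ℝ} {l : ℕ}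
    (hg : ∀ col, ContDiff ℝ l (nodeFun a b col)) (hf : ContDiff ℝ l f) :
    wsum (usum (ftaylorSeries ℝ (stageSum c θ a b) fun _ => x0)) l
      (ftaylorSeries ℝ (fun S : Stack d m s M => f (S none)) fun _ => x0) =
      ∑ t : STree l m, t.densDelta * elemFRoot f a b t x0 * PhiS c θ t := by
  have h := sum_val (L := l) (r := 0) (A := univ)
    (fun col => ftaylorSeries ℝ (stageMap c θ (nodeFun a b) col) fun _ => x0)
    (ftaylorSeries ℝ (fun S : Stack d m s M => f (S none)) fun _ => x0) fun i _ => Nat.zero_le _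
  rw [← STree.sum_data, card_univ, Fintype.card_fin] at h
  simp only [val_stageMap hg hf] at h
  rw [h]
  refine wsum_congr l (fun j hj => usum_congr j fun k hk => ?_) fun k _ => rfl
  have hkl : (k : WithTop ℕ∞) ≤ l := by exact_mod_cast hk.trans hj.le
  exact (iteratedFDeriv_stageSum (fun col => (hg col).of_le hkl) _).trans
    (Finset.sum_apply k univ fun col =>
      ftaylorSeries ℝ (stageMap c θ (nodeFun a b) col) fun _ => x0).symm

theorem norm_iteratedFDeriv_comp_none_le {k : ℕ} (hf : ContDiff ℝ k f) (S : Stack d m s M) :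
    ‖iteratedFDeriv ℝ k (fun S : Stack d m s M => f (S none)) S‖ ≤
      ‖iteratedFDeriv ℝ k f (S none)‖ := by
  refine ContinuousMultilinearMap.opNorm_le_bound (norm_nonneg _) fun v => ?_
  rw [iteratedFDeriv_comp_apply hf]
  refine (ContinuousMultilinearMap.le_opNorm _ _).trans ?_
  gcongr
  exact norm_le_pi_norm _ _

/-- The expansion of the one-step value for a fixed small increment `θ`. -/
theorem exists_abs_sub_sum_le (c : SRK m s M) (hg : ∀ col, ContDiff ℝ (N + 1 : ℕ) (nodeFun a b col))
    (hf : ContDiff ℝ (N + 1 : ℕ) f) (x0 : Evec d) (B : ℝ) :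
    ∃ C η0 : ℝ, 0 < η0 ∧ ∀ η, 0 ≤ η → η ≤ η0 → ∀ θ : Mbar M → ℝ, |θ none| ≤ η ^ 2 →
      (∀ ι, |θ (some ι)| ≤ B * η) → ∀ S : ℝ → Stack d m s M, ContinuousOn S (Set.Icc 0 1) →
      S 0 = (fun _ => x0) →
      (∀ t ∈ Set.Icc (0 : ℝ) 1, S t = (fun _ => x0) + stageSum c (t • θ) a b (S t)) →
      |f (S 1 none) - ∑ l ∈ range (N + 1),
        ∑ t ∈ univ.filter (fun t : STree l m => 2 * t.dcount + t.scount ≤ N),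
          t.densDelta * elemFRoot f a b t x0 * PhiS c θ t / (l.factorial : ℝ)| ≤
        C * η ^ (N + 1) := by
  obtain ⟨Kc, hKc0, hKc⟩ := exists_bound_coef c B
  obtain ⟨Kg, hKg0, hKg⟩ := exists_bound_iteratedFDeriv hg x0 1
  obtain ⟨Kf, hKf0, hKf⟩ := exists_bound_iteratedFDeriv (fun _ : Unit => hf) x0 1
  have hmem : ∀ {S : Stack d m s M}, S ∈ Metric.closedBall (fun _ => x0) 1 → ∀ ι,
      S ι ∈ Metric.closedBall x0 1 := fun hS ι =>
    Metric.mem_closedBall.mpr ((dist_le_pi_dist _ _ ι).trans (Metric.mem_closedBall.mp hS))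
  obtain ⟨R, hR⟩ : ∃ R : ℝ, R = Fintype.card (SIdx m M) * (s * (Kc * Kg)) := ⟨_, rfl⟩
  have hR0 : 0 ≤ R := by rw [hR]; positivity
  obtain ⟨Q, hQ⟩ : ∃ Q : ℝ, Q = (m + 1) * R := ⟨_, rfl⟩
  have hQ0 : 0 ≤ Q := by rw [hQ]; positivity
  have hφ : ContDiff ℝ (N + 1 : ℕ) fun S : Stack d m s M => f (S none) :=
    hf.comp (contDiff_apply ℝ (Evec d) none)
  have hφK : ∀ k ≤ N + 1, ∀ S ∈ Metric.closedBall (fun _ => x0) 1,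
      ‖iteratedFDeriv ℝ k (fun S : Stack d m s M => f (S none)) S‖ ≤ Kf := fun k hk S hS =>
    (norm_iteratedFDeriv_comp_none_le (hf.of_le (by exact_mod_cast hk)) S).trans
      (hKf () k hk _ (hmem hS none))
  have hmap : ∀ η, 0 ≤ η → ∀ θ : Mbar M → ℝ, |θ none| ≤ η ^ 2 → (∀ ι, |θ (some ι)| ≤ B * η) →
      ∀ col, ∀ k ≤ N + 1, ∀ S ∈ Metric.closedBall (fun _ => x0) 1,
      ‖iteratedFDeriv ℝ k (stageMap c θ (nodeFun a b) col) S‖ ≤ R * colorWeight η col := by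
    intro η hη θ h1 h2 col k hk S hS
    refine (norm_iteratedFDeriv_stageMap_le ((hg col).of_le (by exact_mod_cast hk)) S hKg0
      (mul_nonneg hKc0 (colorWeight_nonneg hη col))
      (fun κ j => hKg col k hk _ (hmem hS _)) fun ι κ j h => h ▸ hKc θ η hη h1 h2 ι κ j).trans
      (le_of_eq ?_)
    rw [hR]
    ring
  have hsum : ∀ η, 0 ≤ η → η ≤ 1 → ∀ θ : Mbar M → ℝ, |θ none| ≤ η ^ 2 →
      (∀ ι, |θ (some ι)| ≤ B * η) → ∀ k ≤ N + 1, ∀ S ∈ Metric.closedBall (fun _ => x0) 1,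
      ‖iteratedFDeriv ℝ k (stageSum c θ a b) S‖ ≤ Q * η := by
    intro η hη hη1 θ h1 h2 k hk S hS
    rw [iteratedFDeriv_stageSum fun col => (hg col).of_le (by exact_mod_cast hk)]
    calc _ ≤ ∑ _ : Option (Fin m), R * η := norm_sum_le_of_le _ fun col _ =>
          (hmap η hη θ h1 h2 col k hk S hS).trans (by gcongr; exact colorWeight_le hη hη1 col)
      _ = Q * η := by simp [hQ, mul_assoc]
  have hη0 : 0 < 1 / (Q + 1) := by positivity
  have hη01 : 1 / (Q + 1) ≤ 1 := by rw [div_le_one (by positivity)]; linarith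
  obtain ⟨E, hE⟩ : ∃ E : ℝ, E = Kf * (1 + (N + 1).factorial *
    (((N + 1).factorial * ((N + 1 : ℕ) + 1) : ℝ) ^ (N + 1)) ^ (N + 1)) := ⟨_, rfl⟩
  refine ⟨E * Q ^ (N + 1) + ∑ l ∈ range (N + 1), ∑ _t : STree l m, Kf * (l * R) ^ l, 1 / (Q + 1),
    hη0, fun η hη hηle θ h1 h2 S hSc hS0 hS => ?_⟩
  have hη1 : η ≤ 1 := hηle.trans hη01
  have hQη : Q * η < 1 := by
    have : Q * η ≤ Q * (1 / (Q + 1)) := by gcongr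
    refine this.trans_lt ?_
    rw [mul_one_div, div_lt_one (by positivity)]
    linarith
  have hpath : ‖S 1 - fun _ => x0‖ ≤ 1 := by
    refine norm_sub_le_one_of_path hSc hS0 hS fun t ht y hy => ?_
    have hta : |t| ≤ 1 := by rw [abs_of_nonneg ht.1]; exact ht.2
    have h := hsum η hη hη1 (t • θ)
      (by
        rw [Pi.smul_apply, smul_eq_mul, abs_mul]
        exact (mul_le_of_le_one_left (abs_nonneg _) hta).trans h1)
      (fun ι => by
        rw [Pi.smul_apply, smul_eq_mul, abs_mul]
        exact (mul_le_of_le_one_left (abs_nonneg _) hta).trans (h2 ι)) 0 (Nat.zero_le _) y hy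
    rw [norm_iteratedFDeriv_zero] at h
    exact h.trans_lt hQη
  have hmain := abs_sub_sum_wsum_le (contDiff_stageSum hg) hφ (by positivity : 0 ≤ Q * η) hQη.le
    (hsum η hη hη1 θ h1 h2) hφK
    (by simpa using hS 1 (by simp)) hpath
  have htree : ∀ l ∈ range (N + 1), wsum (usum (ftaylorSeries ℝ (stageSum c θ a b) fun _ => x0)) l
      (ftaylorSeries ℝ (fun S : Stack d m s M => f (S none)) fun _ => x0) / (l.factorial : ℝ) =
      ∑ t ∈ univ.filter (fun t : STree l m => 2 * t.dcount + t.scount ≤ N),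
        t.densDelta * elemFRoot f a b t x0 * PhiS c θ t / (l.factorial : ℝ) +
      ∑ t ∈ univ.filter (fun t : STree l m => ¬ 2 * t.dcount + t.scount ≤ N),
        t.densDelta * elemFRoot f a b t x0 * PhiS c θ t / (l.factorial : ℝ) := fun l hl => by
    have hl' : (l : WithTop ℕ∞) ≤ (N + 1 : ℕ) := by exact_mod_cast (mem_range.mp hl).le
    rw [sum_filter_add_sum_filter_not, ← sum_div,
      wsum_stageSum (fun col => (hg col).of_le hl') (hf.of_le hl')]
  rw [sum_congr rfl htree, sum_add_distrib, ← sub_sub, ← hE] at hmain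
  have hrest : |∑ l ∈ range (N + 1),
      ∑ t ∈ univ.filter (fun t : STree l m => ¬ 2 * t.dcount + t.scount ≤ N),
        t.densDelta * elemFRoot f a b t x0 * PhiS c θ t / (l.factorial : ℝ)| ≤
      (∑ l ∈ range (N + 1), ∑ _t : STree l m, Kf * (l * R) ^ l) * η ^ (N + 1) := by
    rw [sum_mul]
    refine (abs_sum_le_sum_abs _ _).trans (sum_le_sum fun l hl => ?_)
    have hlN : l ≤ N + 1 := (mem_range.mp hl).le
    have hl' : (l : WithTop ℕ∞) ≤ (N + 1 : ℕ) := by exact_mod_cast hlN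
    rw [sum_mul]
    refine (abs_sum_le_sum_abs _ _).trans ((sum_le_sum fun t ht => ?_).trans
      (sum_le_sum_of_subset_of_nonneg (filter_subset _ _) fun t _ _ => by positivity))
    have hx0 : (fun _ => x0 : Stack d m s M) ∈ Metric.closedBall (fun _ => x0) (1 : ℝ) :=
      Metric.mem_closedBall_self zero_le_one
    have h := norm_val_le (L := l) (r := 0) (A := univ) (f := t.data)
      (fun col => ftaylorSeries ℝ (stageMap c θ (nodeFun a b) col) fun _ => x0)
      (κ := fun col => R * colorWeight η col)
      (fun col k hk => hmap η hη θ h1 h2 col k (hk.trans hlN) _ hx0)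
      (ftaylorSeries ℝ (fun S : Stack d m s M => f (S none)) fun _ => x0) (K := Kf)
      (fun k hk => hφK k (by simp at hk; omega) _ hx0) (fun i _ => Nat.zero_le _)
      (mem_trees.mp t.data_mem_trees).1
    rw [val_stageMap (fun col => (hg col).of_le hl') (hf.of_le hl')] at h
    simp only [← mul_assoc, prod_mul_distrib, prod_const, card_univ, Fintype.card_fin] at h
    rw [abs_div, Nat.abs_cast]
    refine (div_le_self (abs_nonneg _)
      (by exact_mod_cast Nat.one_le_iff_ne_zero.mpr l.factorial_ne_zero)).trans (h.trans ?_)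
    have e : ∏ i, colorWeight η (t.data i).2 = η ^ (2 * t.dcount + t.scount) :=
      prod_colorWeight η t
    rw [e, mul_pow (l : ℝ), ← mul_assoc]
    gcongr _ * ?_
    exact pow_le_pow_of_le_one hη hη1 (not_le.mp (mem_filter.mp ht).2)
  calc _ = |(_ - _ - _) + _| := by rw [sub_add_cancel]
    _ ≤ _ + _ := abs_add_le _ _
    _ ≤ E * (Q * η) ^ (N + 1) + _ := add_le_add hmain hrest
    _ = _ := by rw [mul_pow]; ring

end Expansion

section Integration

variable [Fintype M] {Ω : Type} [MeasurableSpace Ω] {P : Measure Ω} [IsProbabilityMeasure P]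

theorem integrable_PhiS (c : SRK m s M) {l : ℕ} (t : STree l m) {θ : Ω → Mbar M → ℝ}
    (hm : Measurable θ) {B : ℝ} (hB : ∀ ω ν, |θ ω ν| ≤ B) :
    Integrable (fun ω => PhiS c (θ ω) t) P := by
  obtain ⟨K, hK⟩ := (isCompact_univ_pi fun _ : Mbar M =>
    isCompact_Icc (a := -B) (b := B)).exists_bound_of_continuousOn (continuous_PhiS c t).continuousOn
  exact Integrable.of_bound ((continuous_PhiS c t).measurable.comp hm).aestronglyMeasurable K
    (Filter.Eventually.of_forall fun ω => hK _ fun ν _ => abs_le.mp (hB ω ν))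

theorem abs_integral_sub_integral_le {X T : Ω → ℝ} {K : ℝ} (hX : AEStronglyMeasurable X P)
    (hT : Integrable T P) (h : ∀ᵐ ω ∂P, |X ω - T ω| ≤ K) : |∫ ω, X ω ∂P - ∫ ω, T ω ∂P| ≤ K := by
  have hXT : Integrable (fun ω => X ω - T ω) P :=
    Integrable.of_bound (hX.sub hT.aestronglyMeasurable) K h
  have hX' : Integrable X P := (hXT.add hT).congr (Filter.Eventually.of_forall fun ω => by simp)
  rw [← integral_sub hX' hT, ← Real.norm_eq_abs]
  simpa using norm_integral_le_of_norm_le_const (f := fun ω => X ω - T ω) h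

end Integration

/-- Expansion of the expected value of a functional of the SRK
approximation up to order `p`, for bounded random inputs `θ_ι(h) = √h·ϑ_ι`. -/
theorem srk_expected_expansion
    (d m s p : ℕ) (M : Type) [Fintype M] [DecidableEq M]
    (c : SRK m s M)
    (f : Evec d → ℝ) (a : Evec d → Evec d) (b : Fin m → Evec d → Evec d)
    (hf : IsCP (2*(p+1)) f)
    (ha : ∀ J : Fin d, IsCP (2*(p+1)) (fun x => a x J))
    (hb : ∀ (k : Fin m) (J : Fin d), IsCP (2*(p+1)) (fun x => b k x J))
    (x0 : Evec d)
    (Ω : Type) [MeasurableSpace Ω] (P : Measure Ω) [IsProbabilityMeasure P]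
    (ϑ : M → Ω → ℝ) (hϑm : ∀ ι, Measurable (ϑ ι))
    (Cb : ℝ) (hϑb : ∀ ι ω, |ϑ ι ω| ≤ Cb)
    (θv : ℝ → Ω → Mbar M → ℝ)
    (hθ : ∀ h ω, θv h ω none = h ∧ ∀ ι : M, θv h ω (some ι) = Real.sqrt h * ϑ ι ω)
    (H : ℝ → Ω → (Mbar M → ℝ) → SIdx m M → Fin s → Evec d)
    (hH : ∀ h, 0 < h → ∀ᵐ ω ∂P,
      (∀ (pp : SIdx m M) (i : Fin s),
        ContDiffOn ℝ (2*p+2) (fun θ => H h ω θ pp i) (segment ℝ 0 (θv h ω)))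
      ∧ ∀ θ ∈ segment ℝ 0 (θv h ω), StageEq c a b x0 θ (H h ω θ))
    (Y : ℝ → Ω → Evec d)
    (hY : ∀ h ω, Y h ω = oneStep c a b x0 (θv h ω) (H h ω (θv h ω)))
    (hYm : ∀ h, AEStronglyMeasurable (Y h) P) :
    ∃ h0 > (0:ℝ), ∃ C : ℝ, ∀ h : ℝ, 0 < h → h < h0 →
      |(∫ ω, f (Y h ω) ∂P) -
        ∑ l ∈ Finset.range (2*p+2),
          ∑ t ∈ Finset.univ.filter (fun t : STree l m => 2 * t.dcount + t.scount ≤ 2*p+1),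
            (t.densDelta : ℝ) * elemFRoot f a b t x0 * (∫ ω, PhiS c (θv h ω) t ∂P)
              / (Nat.factorial l : ℝ)|
        ≤ C * h^(p+1) := by
  have hfc : ContDiff ℝ (2 * p + 1 + 1 : ℕ) f := hf.1
  have hg : ∀ col, ContDiff ℝ (2 * p + 1 + 1 : ℕ) (nodeFun a b col) := fun col => by
    rw [contDiff_euclidean]
    cases col with
    | none => exact fun J => (ha J).1
    | some k => exact fun J => (hb k J).1
  obtain ⟨C, η0, hη0, hC⟩ := exists_abs_sub_sum_le c hg hfc x0 |Cb|
  refine ⟨η0 ^ 2, by positivity, C, fun h hh hh0 => ?_⟩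
  have hsq : Real.sqrt h ^ 2 = h := Real.sq_sqrt hh.le
  have hpow : Real.sqrt h ^ (2 * p + 1 + 1) = h ^ (p + 1) := by
    rw [show 2 * p + 1 + 1 = 2 * (p + 1) by ring, pow_mul, hsq]
  have hη : Real.sqrt h ≤ η0 := Real.sqrt_le_iff.mpr ⟨hη0.le, hh0.le⟩
  have hnone : ∀ ω, |θv h ω none| ≤ Real.sqrt h ^ 2 := fun ω => by
    rw [hsq, (hθ h ω).1, abs_of_pos hh]
  have hsome : ∀ ω ι, |θv h ω (some ι)| ≤ |Cb| * Real.sqrt h := fun ω ι => by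
    rw [(hθ h ω).2 ι, abs_mul, abs_of_nonneg (Real.sqrt_nonneg h), mul_comm]
    exact mul_le_mul_of_nonneg_right ((hϑb ι ω).trans (le_abs_self Cb)) (Real.sqrt_nonneg h)
  have hθm : Measurable (θv h) := measurable_pi_lambda _ fun ν => by
    cases ν with
    | none => simpa only [(hθ h _).1] using measurable_const
    | some ι => simpa only [(hθ h _).2 ι] using (hϑm ι).const_mul (Real.sqrt h)
  have hΦ : ∀ (l : ℕ) (t : STree l m), Integrable (fun ω => PhiS c (θv h ω) t) P := fun l t =>
    integrable_PhiS c t hθm (B := max (Real.sqrt h ^ 2) (|Cb| * Real.sqrt h)) fun ω ν => by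
      cases ν with
      | none => exact (hnone ω).trans (le_max_left _ _)
      | some ι => exact (hsome ω ι).trans (le_max_right _ _)
  have hTi : ∀ l ∈ range (2 * p + 2),
      ∀ t ∈ univ.filter (fun t : STree l m => 2 * t.dcount + t.scount ≤ 2 * p + 1),
      Integrable (fun ω => t.densDelta * elemFRoot f a b t x0 * PhiS c (θv h ω) t /
        (l.factorial : ℝ)) P := fun l _ t _ => ((hΦ l t).const_mul _).div_const _
  have key : ∀ᵐ ω ∂P, |f (Y h ω) - ∑ l ∈ range (2 * p + 2),
      ∑ t ∈ univ.filter (fun t : STree l m => 2 * t.dcount + t.scount ≤ 2 * p + 1),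
        t.densDelta * elemFRoot f a b t x0 * PhiS c (θv h ω) t / (l.factorial : ℝ)| ≤
      C * h ^ (p + 1) := by
    filter_upwards [hH h hh] with ω ⟨hd, he⟩
    have hseg : ∀ t ∈ Set.Icc (0 : ℝ) 1, t • θv h ω ∈ segment ℝ 0 (θv h ω) := fun t ht =>
      segment_eq_image ℝ 0 (θv h ω) ▸ ⟨t, ht, by simp⟩
    have hsm : Continuous fun t : ℝ => t • θv h ω := by fun_prop
    have hS := fun t ht => stack_eq (he _ (hseg t ht))
    have hexp := hC (Real.sqrt h) (Real.sqrt_nonneg h) hη (θv h ω) (hnone ω) (hsome ω)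
      (fun t => stack c a b x0 (t • θv h ω) (H h ω (t • θv h ω)))
      (continuousOn_stack (fun col => (hg col).continuous) hsm fun pp i =>
        (hd pp i).continuousOn.comp hsm.continuousOn hseg)
      (by
        refine (hS 0 (by simp)).trans ?_
        rw [zero_smul, stageSum_zero, add_zero])
      hS
    rw [hpow] at hexp
    simpa only [one_smul, stack, ← hY] using hexp
  have hint := abs_integral_sub_integral_le (hfc.continuous.comp_aestronglyMeasurable (hYm h))
    (integrable_finsetSum _ fun l hl => integrable_finsetSum _ (hTi l hl)) key
  rw [integral_finsetSum _ fun l hl => integrable_finsetSum _ (hTi l hl),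
    sum_congr rfl fun l hl => integral_finsetSum _ (hTi l hl)] at hint
  simpa only [integral_div, integral_const_mul] using hint

end SRKPaper
end
end

section
/- Generalized Faà di Bruno formula over special labelled trees: Let q∈ℕ, let M̄ be a finite index set of cardinality κ+1, let g:ℝ^d→ℝ^r and h:ℝ^{κ+1}→ℝ^d be q-times continuously differentiable, with coordinates of ℝ^{κ+1} indexed θ_ν, ν∈M̄. Then for every component J∈{1,…,r}: Σ_{ν_1,…,ν_q∈M̄} ∂^q (g∘h)^J/(∂θ_{ν_1}⋯∂θ_{ν_q}) = Σ over u∈SLTS_{q+1} of Σ_{K_1,…,K_{m(u)}=1}^d g^J_{K_1…K_{m(u)}}(h) · Π_{i=1}^{m(u)} ( Σ_{ν_1,…,ν_{δ_i}∈M̄} ∂^{δ_i} h^{K_i}/(∂θ_{ν_1}⋯∂θ_{ν_{δ_i}}) ), where g^J_{K_1…K_m} = ∂^m g^J/(∂x^{K_1}⋯∂x^{K_m}) and δ_1,…,δ_{m(u)} are the branch sizes of u (so δ_1+…+δ_{m(u)}=q), the identity holding pointwise on ℝ^{κ+1}. -/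
open scoped BigOperators
open Finset MeasureTheory ProbabilityTheory

noncomputable section

namespace SRKPaper

theorem iteratedFDeriv_comp_perm_of_contDiff {E F : Type*} [NormedAddCommGroup E]
    [NormedSpace ℝ E] [NormedAddCommGroup F] [NormedSpace ℝ F] {f : E → F} {n : ℕ}
    (hf : ContDiff ℝ n f) (x : E) (v : Fin n → E) (σ : Equiv.Perm (Fin n)) :
    iteratedFDeriv ℝ n f x (v ∘ σ) = iteratedFDeriv ℝ n f x v := by
  induction n generalizing x with
  | zero => congr 1; exact Subsingleton.elim _ _
  | succ n ih =>
    have hfn : ContDiff ℝ n f := hf.of_le (by exact_mod_cast n.le_succ)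
    have hd : ∀ x, DifferentiableAt ℝ (iteratedFDeriv ℝ n f) x := fun x =>
      (hf.differentiable_iteratedFDeriv (by exact_mod_cast n.lt_succ_self)) x
    have key : σ ∈ Submonoid.closure
        (Set.range fun i : Fin n => Equiv.swap i.castSucc i.succ) := by
      rw [Equiv.Perm.mclosure_swap_castSucc_succ]; trivial
    induction key using Submonoid.closure_induction generalizing v with
    | one => rfl
    | mul σ τ _ _ hσ hτ =>
      rw [Equiv.Perm.coe_mul, ← Function.comp_assoc, hτ, hσ]
    | mem σ hσ =>
      obtain ⟨i, rfl⟩ := hσ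
      cases n with
      | zero => exact i.elim0
      | succ n =>
        rcases Fin.eq_zero_or_eq_succ i with rfl | ⟨j, rfl⟩
        · have hsymm : IsSymmSndFDerivAt ℝ (iteratedFDeriv ℝ n f) x := by
            refine ContDiffAt.isSymmSndFDerivAt (n := 2) ?_ (by simp)
            refine (hf.iteratedFDeriv_right (m := 2) (i := n) ?_).contDiffAt
            push_cast
            rw [add_comm, add_assoc, one_add_one_eq_two]
          have expand : ∀ w : Fin (n + 2) → E, iteratedFDeriv ℝ (n + 2) f x w =
              fderiv ℝ (fderiv ℝ (iteratedFDeriv ℝ n f)) x (w 0) (w 1)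
                (Fin.tail (Fin.tail w)) := by
            intro w
            have hdd : DifferentiableAt ℝ (fderiv ℝ (iteratedFDeriv ℝ n f)) x :=
              ((hf.iteratedFDeriv_right (m := 2) (i := n) (by
                push_cast
                rw [add_comm, add_assoc, one_add_one_eq_two])).fderiv_right (m := 1)
                (by norm_num)).differentiable one_ne_zero x
            rw [iteratedFDeriv_succ_apply_left,
              ← fderiv_continuousMultilinear_apply_const_apply (hd x)]
            simp only [iteratedFDeriv_succ_apply_left]
            rw [fderiv_continuousMultilinear_apply_const_apply
                (hdd.clm_apply (differentiableAt_const _)),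
              fderiv_clm_apply hdd (differentiableAt_const _)]
            simp [Fin.tail]
          rw [expand, expand, hsymm.eq]
          congr 1
        · have expand : ∀ w : Fin (n + 2) → E, iteratedFDeriv ℝ (n + 2) f x w =
              fderiv ℝ (fun z => iteratedFDeriv ℝ (n + 1) f z (Fin.tail w)) x (w 0) := by
            intro w
            rw [iteratedFDeriv_succ_apply_left, fderiv_continuousMultilinear_apply_const_apply (hd x)]
          have ht : Fin.tail (v ∘ Equiv.swap j.succ.castSucc j.succ.succ) =
              Fin.tail v ∘ Equiv.swap j.castSucc j.succ := by
            funext k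
            simp only [Fin.tail, Function.comp_apply]
            rw [← (Fin.succ_injective _).swap_apply]
            rfl
          rw [expand, expand, ht]
          simp only [ih hfn]
          congr 2

/-- The `m`-th term of the series `A` at `(y a₁, …, y aₘ)`, where `a₁ ≤ … ≤ aₘ` are the elements
of the multiset `s`. -/
def multisetEval {E F : Type*} [NormedAddCommGroup E]
    [NormedSpace ℝ E] [NormedAddCommGroup F] [NormedSpace ℝ F]
    (A : FormalMultilinearSeries ℝ E F) (y : ℕ → E) (s : Multiset ℕ) : F :=
  A (List.equivSigmaTuple (s.sort (· ≤ ·))).1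
    (y ∘ (List.equivSigmaTuple (s.sort (· ≤ ·))).2)

theorem multisetEval_map {E F : Type*} [NormedAddCommGroup E]
    [NormedSpace ℝ E] [NormedAddCommGroup F] [NormedSpace ℝ F]
    (A : FormalMultilinearSeries ℝ E F) (y : ℕ → E) {m : ℕ}
    (hA : ∀ (v : Fin m → E) (σ : Equiv.Perm (Fin m)), A m (v ∘ σ) = A m v) (a : Fin m → ℕ) :
    multisetEval A y (univ.val.map a) = A m (y ∘ a) := by
  have hsort : (univ.val.map a).sort (· ≤ ·) = List.ofFn (a ∘ Tuple.sort a) := by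
    apply List.Perm.eq_of_pairwise (le := (· ≤ ·))
    · intros; omega
    · exact Multiset.pairwise_sort _ _
    · rw [List.pairwise_ofFn]
      intro i j hij
      exact Tuple.monotone_sort a hij.le
    · rw [← Multiset.coe_eq_coe, Multiset.sort_eq, ← Fin.univ_val_map, ← Multiset.map_map]
      congr 1
      exact (Multiset.map_univ_val_equiv (Tuple.sort a)).symm
  have hs : List.equivSigmaTuple ((univ.val.map a).sort (· ≤ ·)) = ⟨m, a ∘ Tuple.sort a⟩ := by
    rw [hsort]
    exact List.equivSigmaTuple.right_inv ⟨m, a ∘ Tuple.sort a⟩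
  rw [multisetEval, hs, ← Function.comp_assoc, hA]

theorem sum_orderedFinpartition_succ (n : ℕ) (F : Multiset ℕ → ℝ) :
    ∑ c : OrderedFinpartition (n + 1), F (univ.val.map c.partSize) =
      ∑ c : OrderedFinpartition n, (F (1 ::ₘ univ.val.map c.partSize) +
        ((univ.val.map c.partSize).map fun a =>
          F ((a + 1) ::ₘ (univ.val.map c.partSize).erase a)).sum) := by
  rw [← (OrderedFinpartition.extendEquiv n).sum_comp, Fintype.sum_sigma]
  refine Finset.sum_congr rfl fun c _ => ?_
  rw [Fintype.sum_option]
  congr 1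
  · congr 1
    change univ.val.map (Fin.cons 1 c.partSize : Fin (c.length + 1) → ℕ) = _
    rw [Fin.univ_succ]
    simp [Function.comp_def]
  · rw [Multiset.map_map]
    change ∑ i, _ = ∑ i, _
    refine Finset.sum_congr rfl fun i _ => ?_
    simp only [Function.comp_apply]
    congr 1
    change univ.val.map (Function.update c.partSize i (c.partSize i + 1)) = _
    have hu : (univ : Finset (Fin c.length)).val = i ::ₘ univ.val.erase i :=
      (Multiset.cons_erase (Finset.mem_univ_val i)).symm
    rw [hu]
    simp only [Multiset.map_cons, Function.update_self, Multiset.erase_cons_head]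
    congr 1
    refine Multiset.map_congr rfl fun j hj => ?_
    rw [Function.update_of_ne]
    rintro rfl
    exact univ.nodup.notMem_erase hj

theorem sizeAux_eq_of_le {l m : ℕ} (t : STree l m) (a b : ℕ) (i : Fin l)
    (ha : l ≤ a + i) (hb : l ≤ b + i) : sizeAux t a i = sizeAux t b i := by
  induction a generalizing b i with
  | zero => exact absurd i.isLt (by omega)
  | succ a ih =>
    cases b with
    | zero => exact absurd i.isLt (by omega)
    | succ b =>
      simp only [sizeAux]
      congr 1
      refine Finset.sum_congr rfl fun c hc => ?_
      have hc' : t.father c = i.succ := by simpa [STree.child] using hc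
      have hm := t.mono c
      rw [hc', Fin.val_succ] at hm
      exact ih b c (by omega) (by omega)

theorem STree.size_eq {l m : ℕ} (t : STree l m) (i : Fin l) :
    t.size i = 1 + ∑ c ∈ t.child i.succ, t.size c := by
  unfold STree.size
  rw [sizeAux_eq_of_le t l (l + 1) i (by omega) (by omega)]
  rfl

/-- The distance of a node from the root. -/
def STree.depth {l m : ℕ} (t : STree l m) (v : Fin (l + 1)) : ℕ :=
  if hv : v = 0 then 0 else t.depth (t.father (v.pred hv)) + 1
termination_by v.val
decreasing_by
  have h1 := t.mono (v.pred hv)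
  have h2 : v.val ≠ 0 := fun h => hv (Fin.ext h)
  rw [Fin.val_pred] at h1
  omega

@[simp]
theorem STree.depth_zero {l m : ℕ} (t : STree l m) : t.depth 0 = 0 := by
  rw [STree.depth]; simp

theorem STree.depth_succ {l m : ℕ} (t : STree l m) (i : Fin l) :
    t.depth i.succ = t.depth (t.father i) + 1 := by
  rw [STree.depth]; simp

theorem STree.depth_le {l m : ℕ} (t : STree l m) (v : Fin (l + 1)) : t.depth v ≤ v := by
  induction hn : v.val using Nat.strong_induction_on generalizing v with
  | _ n ih =>
    induction v using Fin.cases with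
    | zero => simp
    | succ i =>
      have hm := t.mono i
      rw [Fin.val_succ] at hn
      have := ih (t.father i) (by omega) (t.father i) rfl
      rw [STree.depth_succ]
      omega

/-- The multiset of the distances of the nonroot leaves from the root. -/
def STree.leafDepths {l m : ℕ} (t : STree l m) : Multiset ℕ :=
  ∑ i : Fin l, if t.child i.succ = ∅ then {t.depth i.succ} else 0

theorem STree.mem_leafDepths_le {l m : ℕ} (t : STree l m) {a : ℕ} (ha : a ∈ t.leafDepths) :
    a ≤ l := by
  rw [STree.leafDepths, Multiset.mem_sum] at ha
  obtain ⟨i, -, hi⟩ := ha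
  split_ifs at hi
  · rw [Multiset.mem_singleton] at hi
    rw [hi]
    exact (t.depth_le _).trans i.isLt
  · simp at hi

theorem STree.map_size_eq_leafDepths {q : ℕ} {t : STree q 0} (ht : IsSpecial t) :
    (t.child 0).val.map t.size = t.leafDepths := by
  have hsum : (t.child 0).val.map t.size = ∑ c ∈ t.child 0, ({t.size c} : Multiset ℕ) := by
    rw [← Multiset.sum_map_singleton ((t.child 0).val.map t.size), Multiset.map_map]
    rfl
  have htele : ∀ i : Fin q, ({t.size i + t.depth (t.father i)} : Multiset ℕ) =
      (if t.child i.succ = ∅ then {t.depth i.succ} else 0) +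
        ∑ c ∈ t.child i.succ, {t.size c + t.depth i.succ} := by
    intro i
    rcases Nat.le_one_iff_eq_zero_or_eq_one.mp (ht i) with h0 | h1
    · rw [Finset.card_eq_zero] at h0
      rw [STree.size_eq, STree.depth_succ]
      simp [h0, add_comm]
    · obtain ⟨c, hc⟩ := Finset.card_eq_one.mp h1
      rw [STree.size_eq, STree.depth_succ]
      simp [hc, add_comm, add_left_comm, add_assoc]
  have hfib : ∑ i : Fin q, ({t.size i + t.depth (t.father i)} : Multiset ℕ) =
      ∑ c ∈ t.child 0, {t.size c} +
        ∑ i : Fin q, ∑ c ∈ t.child i.succ, {t.size c + t.depth i.succ} := by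
    rw [← Finset.sum_fiberwise _ t.father, Fin.sum_univ_succ]
    congr 1
    · refine Finset.sum_congr rfl fun c hc => ?_
      rw [(Finset.mem_filter.mp hc).2, STree.depth_zero, add_zero]
    · refine Finset.sum_congr rfl fun i _ => Finset.sum_congr rfl fun c hc => ?_
      rw [(Finset.mem_filter.mp hc).2]
  rw [Finset.sum_congr rfl fun i _ => htele i, Finset.sum_add_distrib] at hfib
  rw [hsum]
  exact (add_right_cancel hfib).symm

/-- Attach a new node with the largest label as a son of `v`. -/
def STree.attach {n : ℕ} (t : STree n 0) (v : Fin (n + 1)) : STree (n + 1) 0 where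
  father := Fin.snoc (α := fun _ => Fin (n + 2)) (fun i => (t.father i).castSucc) v.castSucc
  color _ := none
  mono i := by
    induction i using Fin.lastCases with
    | last => simpa using Nat.le_of_lt_succ v.isLt
    | cast i => simpa using t.mono i

@[simp]
theorem STree.father_attach_castSucc {n : ℕ} (t : STree n 0) (v : Fin (n + 1)) (i : Fin n) :
    (t.attach v).father i.castSucc = (t.father i).castSucc := by
  simp [STree.attach]

@[simp]
theorem STree.father_attach_last {n : ℕ} (t : STree n 0) (v : Fin (n + 1)) :
    (t.attach v).father (Fin.last n) = v.castSucc := by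
  simp [STree.attach]

theorem STree.ext_father {n : ℕ} {t u : STree n 0} (h : t.father = u.father) : t = u := by
  cases t; cases u
  simp only [STree.mk.injEq]
  exact ⟨h, Subsingleton.elim _ _⟩

/-- A labelled tree arises uniquely by attaching its last node to the remaining tree. -/
def STree.attachEquiv (n : ℕ) : STree n 0 × Fin (n + 1) ≃ STree (n + 1) 0 where
  toFun p := p.1.attach p.2
  invFun t :=
    (⟨fun i => (t.father i.castSucc).castLT
        (lt_of_le_of_lt (t.mono i.castSucc) (by simp)),
      fun _ => none, fun i => t.mono i.castSucc⟩,
      (t.father (Fin.last n)).castLT (lt_of_le_of_lt (t.mono _) (by simp)))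
  left_inv p := by
    refine Prod.ext (STree.ext_father ?_) ?_
    · funext i
      simp
    · simp
  right_inv t := by
    refine STree.ext_father (funext fun i => ?_)
    induction i using Fin.lastCases with
    | last => simp
    | cast i => simp

theorem STree.depth_attach_castSucc {n : ℕ} (t : STree n 0) (v w : Fin (n + 1)) :
    (t.attach v).depth w.castSucc = t.depth w := by
  induction hn : w.val using Nat.strong_induction_on generalizing w with
  | _ k ih =>
    induction w using Fin.cases with
    | zero => simp
    | succ i =>
      have hm := t.mono i
      rw [Fin.val_succ] at hn
      rw [← Fin.succ_castSucc, STree.depth_succ, STree.depth_succ, father_attach_castSucc,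
        ih (t.father i) (by omega) _ rfl]

theorem STree.child_attach_castSucc {n : ℕ} (t : STree n 0) (v w : Fin (n + 1)) :
    (t.attach v).child w.castSucc =
      if v = w then insert (Fin.last n) ((t.child w).map Fin.castSuccEmb)
      else (t.child w).map Fin.castSuccEmb := by
  ext i
  induction i using Fin.lastCases with
  | last => split_ifs with h <;> simp [STree.child, h]
  | cast i => split_ifs with h <;> simp [STree.child]

theorem STree.child_attach_last {n : ℕ} (t : STree n 0) (v : Fin (n + 1)) :
    (t.attach v).child (Fin.last n).succ = ∅ := by
  ext i
  simp only [STree.child, Finset.mem_filter, Finset.mem_univ, true_and, Finset.notMem_empty,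
    iff_false]
  intro h
  have := (t.attach v).mono i
  rw [h] at this
  simp at this
  omega

theorem STree.isSpecial_attach_iff {n : ℕ} (t : STree n 0) (v : Fin (n + 1)) :
    IsSpecial (t.attach v) ↔ IsSpecial t ∧ (v ≠ 0 → t.child v = ∅) := by
  have hcard : ∀ i : Fin n, ((t.attach v).child i.castSucc.succ).card =
      (t.child i.succ).card + if v = i.succ then 1 else 0 := by
    intro i
    rw [Fin.succ_castSucc, child_attach_castSucc]
    split_ifs with h
    · rw [Finset.card_insert_of_notMem (by simp), Finset.card_map]
    · rw [Finset.card_map, add_zero]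
  unfold IsSpecial
  rw [Fin.forall_fin_succ']
  simp only [hcard, child_attach_last, Finset.card_empty, zero_le, and_true]
  refine ⟨fun h => ⟨fun i => (Nat.le_add_right _ _).trans (h i), fun hv => ?_⟩, ?_⟩
  · obtain ⟨i, rfl⟩ := Fin.exists_succ_eq.mpr hv
    have := h i
    rw [if_pos rfl] at this
    rw [← Finset.card_eq_zero]
    omega
  · rintro ⟨h1, h2⟩ i
    split_ifs with hv
    · subst hv
      rw [h2 (Fin.succ_ne_zero i)]
      simp
    · exact h1 i

theorem STree.leafDepths_attach {n : ℕ} (t : STree n 0) (v : Fin (n + 1)) :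
    (t.attach v).leafDepths = (t.depth v + 1) ::ₘ
      ∑ i : Fin n, if t.child i.succ = ∅ ∧ v ≠ i.succ then {t.depth i.succ} else 0 := by
  rw [STree.leafDepths, Fin.sum_univ_castSucc, child_attach_last, if_pos rfl, STree.depth_succ,
    father_attach_last, depth_attach_castSucc, add_comm, Multiset.singleton_add]
  congr 1
  refine Finset.sum_congr rfl fun i _ => ?_
  rw [Fin.succ_castSucc, child_attach_castSucc, depth_attach_castSucc]
  by_cases hv : v = i.succ
  · simp [hv]
  · simp [hv]

theorem STree.leafDepths_attach_zero {n : ℕ} (t : STree n 0) :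
    (t.attach 0).leafDepths = 1 ::ₘ t.leafDepths := by
  rw [leafDepths_attach, STree.leafDepths]
  simp [(Fin.succ_ne_zero _).symm]

theorem STree.leafDepths_attach_succ {n : ℕ} (t : STree n 0) {j : Fin n}
    (hj : t.child j.succ = ∅) :
    (t.attach j.succ).leafDepths =
      (t.depth j.succ + 1) ::ₘ t.leafDepths.erase (t.depth j.succ) := by
  rw [leafDepths_attach, STree.leafDepths, ← Finset.add_sum_erase _ _ (Finset.mem_univ j),
    ← Finset.add_sum_erase (a := j) univ (fun i => if t.child i.succ = ∅ then _ else _)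
      (Finset.mem_univ j)]
  rw [if_pos hj, if_neg (by simp), Multiset.singleton_add, Multiset.erase_cons_head, zero_add]
  congr 1
  refine Finset.sum_congr rfl fun i hi => ?_
  have : j ≠ i := (Finset.ne_of_mem_erase hi).symm
  simp [this]

theorem STree.sum_map_leafDepths {n : ℕ} (t : STree n 0) (G : ℕ → ℝ) :
    (t.leafDepths.map G).sum =
      ∑ i : Fin n, if t.child i.succ = ∅ then G (t.depth i.succ) else 0 := by
  have := map_sum (Multiset.sumAddMonoidHom.comp (Multiset.mapAddMonoidHom G))
    (fun i : Fin n => if t.child i.succ = ∅ then ({t.depth i.succ} : Multiset ℕ) else 0) univ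
  simp only [AddMonoidHom.coe_comp, Function.comp_apply, Multiset.coe_mapAddMonoidHom,
    Multiset.coe_sumAddMonoidHom] at this
  rw [STree.leafDepths, this]
  refine Finset.sum_congr rfl fun i _ => ?_
  split_ifs <;> simp

theorem sum_isSpecial_succ (n : ℕ) (F : Multiset ℕ → ℝ) :
    ∑ u : {t : STree (n + 1) 0 // IsSpecial t}, F u.1.leafDepths =
      ∑ u : {t : STree n 0 // IsSpecial t}, (F (1 ::ₘ u.1.leafDepths) +
        (u.1.leafDepths.map fun a => F ((a + 1) ::ₘ u.1.leafDepths.erase a)).sum) := by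
  rw [← Finset.sum_subtype (univ.filter IsSpecial) (by simp) fun t => F t.leafDepths,
    ← Finset.sum_subtype (univ.filter IsSpecial) (by simp) fun t : STree n 0 =>
      F (1 ::ₘ t.leafDepths) +
        (t.leafDepths.map fun a => F ((a + 1) ::ₘ t.leafDepths.erase a)).sum,
    Finset.sum_filter, Finset.sum_filter, ← (STree.attachEquiv n).sum_comp,
    Fintype.sum_prod_type]
  refine Finset.sum_congr rfl fun t _ => ?_
  change ∑ v, (if IsSpecial (t.attach v) then F (t.attach v).leafDepths else 0) = _
  simp only [STree.isSpecial_attach_iff]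
  split_ifs with ht
  · rw [Fin.sum_univ_succ, STree.sum_map_leafDepths]
    simp only [ht, ne_eq, not_true_eq_false, false_imp_iff, and_self, if_true,
      Fin.succ_ne_zero, not_false_eq_true, true_imp_iff, true_and, STree.leafDepths_attach_zero]
    congr 1
    refine Finset.sum_congr rfl fun j _ => ?_
    split_ifs with hj
    · rw [STree.leafDepths_attach_succ t hj]
    · rfl
  · simp [ht]

theorem sum_isSpecial_eq_sum_orderedFinpartition (n : ℕ) (F : Multiset ℕ → ℝ) :
    ∑ u : {t : STree n 0 // IsSpecial t}, F u.1.leafDepths =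
      ∑ c : OrderedFinpartition n, F (univ.val.map c.partSize) := by
  induction n generalizing F with
  | zero =>
    have hu : Unique {t : STree 0 0 // IsSpecial t} :=
      { default := ⟨⟨Fin.elim0, Fin.elim0, fun i => i.elim0⟩, fun i => i.elim0⟩
        uniq := fun t => Subtype.ext (STree.ext_father (Subsingleton.elim _ _)) }
    rw [Fintype.sum_unique, Fintype.sum_unique]
    rfl
  | succ n ih =>
    rw [sum_isSpecial_succ, sum_orderedFinpartition_succ]
    exact ih fun s => F (1 ::ₘ s) + (s.map fun a => F ((a + 1) ::ₘ s.erase a)).sum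

theorem sum_apply_single {ι F : Type*} [Fintype ι] [DecidableEq ι] [NormedAddCommGroup F]
    [NormedSpace ℝ F] {n : ℕ} (A : ContinuousMultilinearMap ℝ (fun _ : Fin n => ι → ℝ) F) :
    ∑ νs : Fin n → ι, A (fun p => Pi.single (νs p) 1) = A fun _ => 1 := by
  rw [← A.map_sum fun _ ν => (Pi.single ν 1 : ι → ℝ)]
  congr 1
  funext _
  exact Finset.univ_sum_single (1 : ι → ℝ)

theorem sum_apply_euclideanSingle_mul_prod {d m : ℕ}
    (B : ContinuousMultilinearMap ℝ (fun _ : Fin m => Evec d) ℝ) (w : Fin m → Evec d) :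
    ∑ Ks : Fin m → Fin d, B (fun p => EuclideanSpace.single (Ks p) (1 : ℝ)) *
      ∏ p, w p (Ks p) = B w := by
  have hw : w = fun p => ∑ K, w p K • EuclideanSpace.single K (1 : ℝ) := by
    funext p
    ext K
    simp [Pi.single_apply]
  conv_rhs => rw [hw, B.map_sum]
  refine Finset.sum_congr rfl fun Ks _ => ?_
  rw [B.map_smul_univ (fun p => w p (Ks p)), smul_eq_mul, mul_comm]

/-- Generalized Faà di Bruno formula over special labelled trees.
`SLTS_{q+1}` is encoded as `{u : STree q 0 // IsSpecial u}` (trees with `q+1` nodes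
having ramifications only at the root); `m(u)` is the number of sons of the root and
the branch sizes `δ_i` are the subtree sizes of the sons of the root. -/
theorem faa_di_bruno_special_trees
    (d r q : ℕ) (hq : 0 < q) (ι : Type) [Fintype ι] [DecidableEq ι]
    (g : Evec d → Evec r) (h : (ι → ℝ) → Evec d)
    (hg : ContDiff ℝ q g) (hh : ContDiff ℝ q h) :
    ∀ (J : Fin r) (θ : ι → ℝ),
      (∑ νs : Fin q → ι,
        iteratedFDeriv ℝ q (fun θ' => g (h θ') J) θ (fun p => Pi.single (νs p) 1))
      = ∑ u : {t : STree q 0 // IsSpecial t},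
          ∑ Ks : Fin (u.1.child 0).card → Fin d,
            iteratedFDeriv ℝ (u.1.child 0).card (fun x => g x J) (h θ)
                (fun p => EuclideanSpace.single (Ks p) (1:ℝ))
              * ∏ p : Fin (u.1.child 0).card,
                  ∑ νs : Fin (u.1.size (((u.1.child 0).orderIsoOfFin rfl p).1)) → ι,
                    iteratedFDeriv ℝ (u.1.size (((u.1.child 0).orderIsoOfFin rfl p).1))
                      (fun θ' => h θ' (Ks p)) θ (fun p' => Pi.single (νs p') 1) := by
  intro J θ
  have hgJ : ContDiff ℝ q fun x => g x J :=
    (EuclideanSpace.proj (𝕜 := ℝ) J : Evec r →L[ℝ] ℝ).contDiff.comp hg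
  set A := ftaylorSeries ℝ (fun x => g x J) (h θ)
  set y : ℕ → Evec d := fun δ => iteratedFDeriv ℝ δ h θ fun _ => 1
  have hEval : ∀ {m : ℕ} (a : Fin m → ℕ), m ≤ q →
      multisetEval A y (univ.val.map a) = iteratedFDeriv ℝ m (fun x => g x J) (h θ) (y ∘ a) :=
    fun a hm => multisetEval_map A y
      (iteratedFDeriv_comp_perm_of_contDiff (hgJ.of_le (by exact_mod_cast hm)) (h θ)) a
  have hcoord : ∀ (δ : ℕ) (K : Fin d), δ ≤ q →
      ∑ νs : Fin δ → ι, iteratedFDeriv ℝ δ (fun θ' => h θ' K) θ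
        (fun p => Pi.single (νs p) 1) = y δ K := by
    intro δ K hδ
    rw [sum_apply_single]
    exact congrArg (fun T => T fun _ => (1 : ι → ℝ))
      ((EuclideanSpace.proj (𝕜 := ℝ) K : Evec d →L[ℝ] ℝ).iteratedFDeriv_comp_left
        hh.contDiffAt (i := δ) (by exact_mod_cast hδ))
  have hleft : iteratedFDeriv ℝ q (fun θ' => g (h θ') J) θ (fun _ => 1) =
      ∑ c : OrderedFinpartition q, multisetEval A y (univ.val.map c.partSize) := by
    have hcomp := iteratedFDeriv_comp (x := θ) hgJ.contDiffAt hh.contDiffAt le_rfl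
    change iteratedFDeriv ℝ q ((fun x => g x J) ∘ h) θ _ = _
    rw [hcomp, FormalMultilinearSeries.taylorComp, _root_.sum_apply]
    refine Finset.sum_congr rfl fun c _ => ?_
    rw [hEval _ c.length_le]
    rfl
  rw [sum_apply_single, hleft, ← sum_isSpecial_eq_sum_orderedFinpartition]
  refine Finset.sum_congr rfl fun u _ => ?_
  have hsizes := STree.map_size_eq_leafDepths u.2
  have hmap : univ.val.map (fun p => u.1.size ((u.1.child 0).orderIsoOfFin rfl p).1) =
      u.1.leafDepths := by
    have hval := congrArg (fun s => s.val.map u.1.size)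
      (Finset.map_orderEmbOfFin_univ (u.1.child 0) rfl)
    rw [Finset.map_val, Multiset.map_map] at hval
    exact hval.trans hsizes
  have hle : ∀ p, u.1.size ((u.1.child 0).orderIsoOfFin rfl p).1 ≤ q := fun p =>
    u.1.mem_leafDepths_le (hsizes ▸ Multiset.mem_map_of_mem _
      ((u.1.child 0).orderIsoOfFin rfl p).2)
  rw [← hmap, hEval _ (by simpa using Finset.card_le_univ (u.1.child 0)),
    ← sum_apply_euclideanSingle_mul_prod]
  refine Finset.sum_congr rfl fun Ks _ => ?_
  congr 1
  exact Finset.prod_congr rfl fun p _ => (hcoord _ _ (hle p)).symm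

end SRKPaper
end
end
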